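/- arXiv:1004.0994 — 9 statements merged into one kernel-verified Lean document; each statement's English description precedes it below -/
import Mathlib

section
/- Let R be an integrally closed noetherian domain with field of fractions F, let O be an R-algebra that is finitely generated and torsion-free as an R-module, and let B = O ⊗_R F. Then for every positive integer n, the following are equivalent: (i) every element of O is a root of a monic polynomial of degree at most n with coefficients in R; (ii) every element of B is a root of a monic polynomial of degree at most n with coefficients in F. (Hence the degree of O over R equals the degree of B over F.) -/
open scoped TensorProduct

/-- A monic factor over the fraction field of a monic polynomial over an integrally closed domain
lifts to a monic polynomial of the same degree. -/
theorem Polynomial.Monic.exists_map_eq_of_dvd_map {R F : Type*} [CommRing R] [IsDomain R]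
    [IsIntegrallyClosed R] [Field F] [Algebra R F] [IsFractionRing R F] {p : Polynomial R}
    (hp : p.Monic) {q : Polynomial F} (hq : q.Monic) (h : q ∣ p.map (algebraMap R F)) :
    ∃ r : Polynomial R, r.map (algebraMap R F) = q ∧ r.Monic ∧ r.natDegree = q.natDegree := by
  obtain ⟨g, hg⟩ := IsIntegrallyClosed.eq_map_mul_C_of_dvd F hp h
  rw [hq.leadingCoeff, map_one, mul_one] at hg
  refine ⟨g, hg, Polynomial.monic_of_injective (IsFractionRing.injective R F) (hg ▸ hq), ?_⟩
  rw [← hg, Polynomial.natDegree_map_eq_of_injective (IsFractionRing.injective R F)]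

/-- Let `R` be an integrally closed noetherian domain with field of
fractions `F`, let `O` be an `R`-algebra that is finitely generated and torsion-free
as an `R`-module, and let `B = F ⊗[R] O`.  Then for every positive integer `n`, every
element of `O` is a root of a monic polynomial of degree at most `n` with coefficients
in `R` if and only if every element of `B` is a root of a monic polynomial of degree at
most `n` with coefficients in `F`. -/
theorem degree_algebra_eq_degree_baseChange
    (R F O : Type*) [CommRing R] [IsDomain R] [IsNoetherianRing R] [IsIntegrallyClosed R]
    [Field F] [Algebra R F] [IsFractionRing R F]
    [Ring O] [Algebra R O] [Module.Finite R O] [NoZeroSMulDivisors R O]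
    (n : ℕ) (hn : 0 < n) :
    (∀ x : O, ∃ p : Polynomial R, p.Monic ∧ p.natDegree ≤ n ∧ Polynomial.aeval x p = 0) ↔
      (∀ x : F ⊗[R] O, ∃ p : Polynomial F, p.Monic ∧ p.natDegree ≤ n ∧
        Polynomial.aeval x p = 0) := by
  have hloc : IsLocalizedModule (nonZeroDivisors R) (TensorProduct.mk R F O 1) :=
    (isLocalizedModule_iff_isBaseChange (nonZeroDivisors R) F _).mpr
      (TensorProduct.isBaseChange R O F)
  have haeval (p : Polynomial R) (a : O) :
      Polynomial.aeval ((1 : F) ⊗ₜ[R] a) (p.map (algebraMap R F)) =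
        (1 : F) ⊗ₜ[R] Polynomial.aeval a p := by
    rw [Polynomial.aeval_map_algebraMap]
    exact Polynomial.aeval_algHom_apply
      (Algebra.TensorProduct.includeRight : O →ₐ[R] F ⊗[R] O) a p
  constructor
  · intro h x
    obtain ⟨⟨a, s⟩, hs⟩ := IsLocalizedModule.surj (nonZeroDivisors R) (TensorProduct.mk R F O 1) x
    obtain ⟨p, hp, hpn, hpa⟩ := h a
    set c : F := algebraMap R F s
    have hc : c ≠ 0 := IsFractionRing.to_map_ne_zero_of_mem_nonZeroDivisors s.2
    have hcx : algebraMap F (F ⊗[R] O) c * x = (1 : F) ⊗ₜ[R] a := by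
      rw [← Algebra.smul_def, algebraMap_smul]
      exact hs
    set q : Polynomial F := (p.map (algebraMap R F)).comp (Polynomial.C c * Polynomial.X)
    have hdeg : q.natDegree = p.natDegree := by
      rw [Polynomial.natDegree_comp, Polynomial.natDegree_C_mul_X c hc, mul_one,
        hp.natDegree_map]
    have hq : q ≠ 0 := by
      intro h0
      rw [Polynomial.comp_C_mul_X_eq_zero_iff (mem_nonZeroDivisors_of_ne_zero hc)] at h0
      exact (hp.map (algebraMap R F)).ne_zero h0
    refine ⟨q * Polynomial.C q.leadingCoeff⁻¹, Polynomial.monic_mul_leadingCoeff_inv hq, ?_, ?_⟩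
    · rw [Polynomial.natDegree_mul_leadingCoeff_inv q hq, hdeg]
      exact hpn
    · have hqx : Polynomial.aeval x q = 0 := by
        rw [Polynomial.aeval_comp, map_mul, Polynomial.aeval_C, Polynomial.aeval_X, hcx, haeval,
          hpa, TensorProduct.tmul_zero]
      rw [map_mul, hqx, zero_mul]
  · intro h x
    obtain ⟨p, hp, hpx⟩ := Algebra.IsIntegral.isIntegral (R := R) x
    obtain ⟨f, hf, hfn, hfx⟩ := h ((1 : F) ⊗ₜ[R] x)
    have hint : IsIntegral F ((1 : F) ⊗ₜ[R] x) := ⟨f, hf, hfx⟩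
    have hdvd : minpoly F ((1 : F) ⊗ₜ[R] x) ∣ p.map (algebraMap R F) := by
      apply minpoly.dvd
      rw [haeval, Polynomial.aeval_def, hpx, TensorProduct.tmul_zero]
    obtain ⟨g, hg, hgm, hgn⟩ := hp.exists_map_eq_of_dvd_map (minpoly.monic hint) hdvd
    refine ⟨g, hgm, ?_, ?_⟩
    · rw [hgn]
      exact (Polynomial.natDegree_le_of_dvd (minpoly.dvd F _ hfx) hf.ne_zero).trans hfn
    · have h0 : TensorProduct.mk R F O 1 (Polynomial.aeval x g) = 0 := by
        rw [TensorProduct.mk_apply, ← haeval, hg, minpoly.aeval]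
      obtain ⟨c, hc⟩ := (IsLocalizedModule.eq_zero_iff (nonZeroDivisors R) _).mp h0
      exact (smul_eq_zero.mp (show (c : R) • _ = _ from hc)).resolve_left
        (nonZeroDivisors.ne_zero c.2)
end

section
/- Let R be an integrally closed noetherian domain with field of fractions F, let O be an R-algebra that is finitely generated and torsion-free as an R-module, and let B = O ⊗_R F. Then O has a standard involution (over R) if and only if B has a standard involution (over F). -/
open scoped TensorProduct

/-- A standard involution on an associative unital `R`-algebra `A` is an `R`-linear map
`σ : A → A` with `σ 1 = 1`, `σ (x * y) = σ y * σ x`, `σ (σ x) = x`, and such that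
`x * σ x` lies in the image of `R` in `A` for every `x`. -/
def IsStandardInvolution (R A : Type*) [CommRing R] [Ring A] [Algebra R A]
    (σ : A →ₗ[R] A) : Prop :=
  σ 1 = 1 ∧ (∀ x y : A, σ (x * y) = σ y * σ x) ∧ (∀ x : A, σ (σ x) = x) ∧
    ∀ x : A, x * σ x ∈ (algebraMap R A).range

/-- Over an integrally closed domain, the coefficients of a quadratic equation over the fraction
field satisfied by a non-scalar integral element are themselves integral. -/
theorem IsIntegral.coeffs_mem_range_of_quadratic
    {R F B : Type*} [CommRing R] [IsDomain R] [IsIntegrallyClosed R]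
    [Field F] [Algebra R F] [IsFractionRing R F]
    [Ring B] [Nontrivial B] [Algebra R B] [Algebra F B] [IsScalarTower R F B]
    {x : B} (hx : IsIntegral R x) (hxF : x ∉ (algebraMap F B).range) {t n : F}
    (h : x * x - algebraMap F B t * x + algebraMap F B n = 0) :
    t ∈ (algebraMap R F).range ∧ n ∈ (algebraMap R F).range := by
  have hxi : IsIntegral F x := hx.tower_top
  have hq : (Polynomial.X ^ 2 + (Polynomial.C (-t) * Polynomial.X + Polynomial.C n)).Monic :=
    Polynomial.monic_X_pow_add (Polynomial.degree_linear_le.trans_lt (by norm_num))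
  have hqdeg : (Polynomial.X ^ 2 +
      (Polynomial.C (-t) * Polynomial.X + Polynomial.C n)).natDegree = 2 := by
    compute_degree!
  have hmin : Polynomial.X ^ 2 + (Polynomial.C (-t) * Polynomial.X + Polynomial.C n) =
      minpoly F x := by
    refine Polynomial.eq_of_monic_of_dvd_of_natDegree_le (minpoly.monic hxi) hq
      (minpoly.dvd F x ?_) ?_
    · simp only [map_add, map_mul, map_pow, Polynomial.aeval_X, Polynomial.aeval_C, map_neg]
      rw [← h]
      noncomm_ring
    · rw [hqdeg]
      exact (minpoly.two_le_natDegree_iff hxi).2 hxF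
  obtain ⟨f, hf, hfx⟩ := hx
  have hdvd : minpoly F x ∣ f.map (algebraMap R F) := minpoly.dvd F x (by
    rw [Polynomial.aeval_map_algebraMap, Polynomial.aeval_def, hfx])
  obtain ⟨g, hg⟩ := IsIntegrallyClosed.eq_map_mul_C_of_dvd F hf hdvd
  rw [(minpoly.monic hxi).leadingCoeff, Polynomial.C_1, mul_one, ← hmin] at hg
  refine ⟨⟨-g.coeff 1, ?_⟩, ⟨g.coeff 0, ?_⟩⟩
  · rw [map_neg, ← Polynomial.coeff_map, hg]
    simp [Polynomial.coeff_X_pow]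
  · rw [← Polynomial.coeff_map, hg]
    simp

/-- The sum of an element and its image under a standard involution is a scalar. -/
theorem IsStandardInvolution.add_mem_range {R A : Type*} [CommRing R] [Ring A] [Algebra R A]
    {σ : A →ₗ[R] A} (h : IsStandardInvolution R A σ) (x : A) :
    x + σ x ∈ (algebraMap R A).range := by
  have key : x + σ x = (1 + x) * σ (1 + x) - x * σ x - 1 := by
    rw [map_add, h.1]
    noncomm_ring
  rw [key]
  exact sub_mem (sub_mem (h.2.2.2 _) (h.2.2.2 _)) (one_mem _)

/-- A standard involution fixes scalars. -/
theorem IsStandardInvolution.map_algebraMap {R A : Type*} [CommRing R] [Ring A] [Algebra R A]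
    {σ : A →ₗ[R] A} (h : IsStandardInvolution R A σ) (r : R) :
    σ (algebraMap R A r) = algebraMap R A r := by
  rw [Algebra.algebraMap_eq_smul_one, map_smul, h.1]

/-- Over an integrally closed domain, the trace and norm of an integral element with respect to a
standard involution over the fraction field are integral. -/
theorem IsStandardInvolution.exists_trace_norm_of_isIntegral
    {R F B : Type*} [CommRing R] [IsDomain R] [IsIntegrallyClosed R]
    [Field F] [Algebra R F] [IsFractionRing R F]
    [Ring B] [Algebra R B] [Algebra F B] [IsScalarTower R F B]
    {τ : B →ₗ[F] B} (h : IsStandardInvolution F B τ) {x : B} (hx : IsIntegral R x) :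
    (∃ t : R, x + τ x = algebraMap R B t) ∧ ∃ n : R, x * τ x = algebraMap R B n := by
  rcases subsingleton_or_nontrivial B with _ | _
  · exact ⟨⟨0, Subsingleton.elim _ _⟩, ⟨0, Subsingleton.elim _ _⟩⟩
  by_cases hxF : x ∈ (algebraMap F B).range
  · obtain ⟨y, rfl⟩ := hxF
    have hy : IsIntegral R y := (isIntegral_algebraMap_iff (algebraMap F B).injective).1 hx
    obtain ⟨r, rfl⟩ := IsIntegrallyClosed.isIntegral_iff.1 hy
    rw [h.map_algebraMap, ← IsScalarTower.algebraMap_apply R F B]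
    exact ⟨⟨r + r, (map_add _ _ _).symm⟩, ⟨r * r, (map_mul _ _ _).symm⟩⟩
  · obtain ⟨t, ht⟩ := h.add_mem_range x
    obtain ⟨n, hn⟩ := h.2.2.2 x
    have hquad : x * x - algebraMap F B t * x + algebraMap F B n = 0 := by
      rw [Algebra.commutes, ht, hn]
      noncomm_ring
    obtain ⟨⟨t, rfl⟩, ⟨n, rfl⟩⟩ := hx.coeffs_mem_range_of_quadratic hxF hquad
    rw [← IsScalarTower.algebraMap_apply R F B] at ht hn
    exact ⟨⟨t, ht.symm⟩, ⟨n, hn.symm⟩⟩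

/-- A torsion-free algebra over a domain embeds into its base change to the fraction field. -/
theorem Algebra.TensorProduct.includeRight_injective_of_isFractionRing
    (R F O : Type*) [CommRing R] [IsDomain R] [Field F] [Algebra R F] [IsFractionRing R F]
    [Ring O] [Algebra R O] [NoZeroSMulDivisors R O] :
    Function.Injective (Algebra.TensorProduct.includeRight : O →ₐ[R] F ⊗[R] O) := by
  intro a b hab
  obtain ⟨c, hc⟩ := (IsLocalizedModule.eq_iff_exists (nonZeroDivisors R)
    (TensorProduct.mk R F O 1)).1 hab
  exact smul_right_injective O (nonZeroDivisors.coe_ne_zero c) hc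

/-- A standard involution extends to the base change to the fraction field. -/
theorem IsStandardInvolution.baseChange
    {R F O : Type*} [CommRing R] [IsDomain R] [Field F] [Algebra R F] [IsFractionRing R F]
    [Ring O] [Algebra R O] {σ : O →ₗ[R] O} (h : IsStandardInvolution R O σ) :
    IsStandardInvolution F (F ⊗[R] O) (σ.baseChange F) := by
  obtain ⟨h1, hmul, hinv, hnorm⟩ := h
  refine ⟨by simp [Algebra.TensorProduct.one_def, h1], fun x y ↦ ?_, fun x ↦ ?_, fun x ↦ ?_⟩
  · induction x with
    | zero => simp
    | add x₁ x₂ hx₁ hx₂ => rw [add_mul, map_add, map_add, mul_add, hx₁, hx₂]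
    | tmul a u =>
      induction y with
      | zero => simp
      | add y₁ y₂ hy₁ hy₂ => rw [mul_add, map_add, map_add, add_mul, hy₁, hy₂]
      | tmul b v => simp [hmul, mul_comm a b]
  · induction x with
    | zero => simp
    | add x₁ x₂ hx₁ hx₂ => rw [map_add, map_add, hx₁, hx₂]
    | tmul a u => simp [hinv]
  · obtain ⟨⟨u, s⟩, hs⟩ := IsLocalizedModule.surj (nonZeroDivisors R) (TensorProduct.mk R F O 1) x
    have hs0 : algebraMap R F s ≠ 0 :=
      IsFractionRing.to_map_ne_zero_of_mem_nonZeroDivisors s.2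
    have hx : x = (algebraMap R F s)⁻¹ • (1 ⊗ₜ[R] u) := by
      rw [eq_inv_smul_iff₀ hs0, algebraMap_smul]
      exact hs
    obtain ⟨n, hn⟩ := hnorm u
    refine ⟨(algebraMap R F s)⁻¹ * (algebraMap R F s)⁻¹ * algebraMap R F n, ?_⟩
    rw [hx, map_smul, smul_mul_smul_comm, LinearMap.baseChange_tmul,
      Algebra.TensorProduct.tmul_mul_tmul, ← hn, mul_one, map_mul,
      ← IsScalarTower.algebraMap_apply R F (F ⊗[R] O), ← Algebra.smul_def]
    congr 1
    exact (Algebra.TensorProduct.includeRight (R := R) (A := F) (B := O)).commutes n |>.symm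

/-- Let `R` be an integrally closed noetherian domain with field of
fractions `F`, let `O` be an `R`-algebra that is finitely generated and torsion-free as
an `R`-module, and let `B = F ⊗[R] O`.  Then `O` has a standard involution over `R` if
and only if `B` has a standard involution over `F`. -/
theorem hasStandardInvolution_iff_baseChange
    (R F O : Type*) [CommRing R] [IsDomain R] [IsNoetherianRing R] [IsIntegrallyClosed R]
    [Field F] [Algebra R F] [IsFractionRing R F]
    [Ring O] [Algebra R O] [Module.Finite R O] [NoZeroSMulDivisors R O] :
    (∃ σ : O →ₗ[R] O, IsStandardInvolution R O σ) ↔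
      (∃ τ : (F ⊗[R] O) →ₗ[F] (F ⊗[R] O), IsStandardInvolution F (F ⊗[R] O) τ) := by
  constructor
  · rintro ⟨σ, h⟩
    exact ⟨σ.baseChange F, h.baseChange⟩
  · rintro ⟨τ, h⟩
    let ι : O →ₐ[R] F ⊗[R] O := Algebra.TensorProduct.includeRight
    have hι : Function.Injective ι :=
      Algebra.TensorProduct.includeRight_injective_of_isFractionRing R F O
    have hint (x : O) : IsIntegral R (ι x) := (Algebra.IsIntegral.isIntegral x).map ι
    have hσ (x : O) : ∃ y : O, ι y = τ (ι x) := by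
      obtain ⟨t, ht⟩ := (h.exists_trace_norm_of_isIntegral (hint x)).1
      exact ⟨algebraMap R O t - x, by rw [map_sub, ι.commutes, ← ht, add_sub_cancel_left]⟩
    choose σ hσ using hσ
    refine ⟨{ toFun := σ, map_add' := fun x y ↦ hι ?_, map_smul' := fun r x ↦ hι ?_ },
      hι ?_, fun x y ↦ hι ?_, fun x ↦ hι ?_, fun x ↦ ?_⟩
    · simp only [map_add, hσ]
    · simp only [map_smul, hσ, RingHom.id_apply, LinearMap.map_smul_of_tower]
    · simp only [LinearMap.coe_mk, AddHom.coe_mk, hσ, map_one, h.1]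
    · simp only [LinearMap.coe_mk, AddHom.coe_mk, hσ, map_mul, h.2.1]
    · simp only [LinearMap.coe_mk, AddHom.coe_mk, hσ, h.2.2.1]
    · obtain ⟨n, hn⟩ := (h.exists_trace_norm_of_isIntegral (hint x)).2
      refine ⟨n, hι ?_⟩
      simp only [LinearMap.coe_mk, AddHom.coe_mk, map_mul, hσ, hn, ι.commutes]
end

section
/- Let R be an integrally closed noetherian domain and let S be an R-algebra that is finitely generated projective of rank 2 as an R-module. Then S is commutative, and S has a standard involution; moreover, this standard involution is unique. -/
open TensorProduct in
theorem LinearMap.exists_forall_trace_baseChange_eq (R M : Type*) [CommRing R] [AddCommGroup M]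
    [Module R M] [Module.Finite R M] [Module.Projective R M] :
    ∃ T : (M →ₗ[R] M) →ₗ[R] R, ∀ (K : Type*) [Field K] [Algebra R K] (f : M →ₗ[R] M),
      LinearMap.trace K (K ⊗[R] M) (f.baseChange K) = algebraMap R K (T f) := by
  obtain ⟨n, p, s, -, -, hps⟩ := Module.Finite.exists_comp_eq_id_of_projective R M
  refine ⟨LinearMap.trace R (Fin n → R) ∘ₗ LinearMap.llcomp R (Fin n → R) M (Fin n → R) s ∘ₗ
    LinearMap.lcomp R M p, fun K _ _ f ↦ ?_⟩
  have key : (LinearMap.trace R (Fin n → R) ∘ₗ LinearMap.llcomp R (Fin n → R) M (Fin n → R) s ∘ₗ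
      LinearMap.lcomp R M p) f = LinearMap.trace R (Fin n → R) (s ∘ₗ f ∘ₗ p) := rfl
  rw [key, ← LinearMap.trace_baseChange, LinearMap.baseChange_comp, LinearMap.trace_comp_comm',
    ← LinearMap.baseChange_comp, LinearMap.comp_assoc, hps, LinearMap.comp_id]

theorem Algebra.exists_sq_eq_trace_smul_sub_algebraMap {K L : Type*} [Field K] [Ring L]
    [Algebra K L] (h : Module.finrank K L = 2) (x : L) :
    ∃ d : K, x * x = LinearMap.trace K L (LinearMap.mul K L x) • x - algebraMap K L d := by
  have : FiniteDimensional K L := Module.finite_of_finrank_pos (by omega)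
  let b := Module.finBasisOfFinrankEq K L h
  refine ⟨(Algebra.leftMulMatrix b x).det, Algebra.leftMulMatrix_injective b ?_⟩
  have hc := Matrix.aeval_self_charpoly (Algebra.leftMulMatrix b x)
  rw [Matrix.charpoly_fin_two] at hc
  simp only [map_add, map_sub, map_mul, map_pow, Polynomial.aeval_X, Polynomial.aeval_C] at hc
  have htr : LinearMap.trace K L (LinearMap.mul K L x) = (Algebra.leftMulMatrix b x).trace :=
    LinearMap.trace_eq_matrix_trace K b _
  rw [htr, map_mul, map_sub, map_smul, AlgHom.commutes,
    Algebra.smul_def, ← sub_eq_zero, ← hc, sq]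
  abel

theorem Module.finrank_baseChange_fractionRing (R M : Type*) [CommRing R] [IsDomain R]
    [AddCommGroup M] [Module R M] :
    Module.finrank (FractionRing R) (TensorProduct R (FractionRing R) M) = Module.finrank R M :=
  (IsFractionRing.finrank_right_eq R _ _).trans <|
    IsLocalizedModule.finrank_eq (nonZeroDivisors R) (TensorProduct.mk R (FractionRing R) M 1) le_rfl

theorem exists_linearMap_one_eq_two_and_quadratic (R S : Type*) [CommRing R] [IsDomain R]
    [IsIntegrallyClosed R] [Ring S] [Algebra R S] [Module.Finite R S] [Module.Projective R S]
    (hrank : Module.finrank R S = 2) :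
    ∃ t : S →ₗ[R] R, t 1 = 2 ∧ ∀ x : S, ∃ n : R, x * x = t x • x - algebraMap R S n := by
  let K := FractionRing R
  let L := TensorProduct R K S
  have hL : Module.finrank K L = 2 := (Module.finrank_baseChange_fractionRing R S).trans hrank
  have : Nontrivial L := Module.nontrivial_of_finrank_pos (R := K) (by omega)
  let ι : S →ₐ[R] L := Algebra.TensorProduct.includeRight
  have hι : Function.Injective ι :=
    Algebra.TensorProduct.includeRight_injective (IsFractionRing.injective R K)
  obtain ⟨T, hT⟩ := LinearMap.exists_forall_trace_baseChange_eq R S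
  let t : S →ₗ[R] R := T ∘ₗ LinearMap.mul R S
  have ht (x : S) : LinearMap.trace K L (LinearMap.mul K L (ι x)) = algebraMap R K (t x) := by
    refine Eq.trans ?_ (hT K (LinearMap.mul R S x))
    congr 1
    ext y
    simp [ι, L]
  refine ⟨t, IsFractionRing.injective R K ?_, fun x ↦ ?_⟩
  · have hone : LinearMap.mul K L 1 = 1 := LinearMap.ext fun y ↦ one_mul y
    rw [← ht, map_one, hone, LinearMap.trace_one, hL, map_ofNat, Nat.cast_ofNat]
  · obtain ⟨d, hd⟩ := Algebra.exists_sq_eq_trace_smul_sub_algebraMap hL (ι x)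
    rw [ht, algebraMap_smul] at hd
    have hd' : algebraMap K L d = ι (t x • x - x * x) := by
      rw [map_sub, map_smul, map_mul, hd]
      abel
    have hint : IsIntegral R (algebraMap K L d) := hd' ▸ (IsIntegral.of_finite R _).map ι
    obtain ⟨n, hn⟩ := IsIntegrallyClosed.isIntegral_iff.mp <|
      (isIntegral_algebraMap_iff (algebraMap K L).injective).mp hint
    refine ⟨n, hι ?_⟩
    rw [map_mul, map_sub, map_smul, AlgHom.commutes, hd, ← hn,
      ← IsScalarTower.algebraMap_apply R K L]

theorem IsStandardInvolution.exists_add_eq_algebraMap {R S : Type*} [CommRing R] [Ring S]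
    [Algebra R S] {σ : S →ₗ[R] S} (hσ : IsStandardInvolution R S σ) (x : S) :
    ∃ t : R, x + σ x = algebraMap R S t := by
  obtain ⟨h1, -, -, hn⟩ := hσ
  obtain ⟨m, hm⟩ := hn x
  obtain ⟨n, hn⟩ := hn (x + 1)
  refine ⟨n - m - 1, ?_⟩
  rw [map_sub, map_sub, hm, hn, map_add, h1, map_one]
  noncomm_ring

section RankTwo

variable {R S : Type*} [CommRing R] [IsDomain R] [Ring S] [Algebra R S]
  [Module.IsTorsionFree R S]

theorem exists_smul_eq_algebraMap_add_smul_of_rank_eq_two [Nontrivial S]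
    (hrank : Module.rank R S = 2) (x y : S) :
    (∃ a b c : R, c ≠ 0 ∧ c • y = algebraMap R S a + b • x) ∨
      ∃ a b : R, b ≠ 0 ∧ b • x = algebraMap R S a := by
  have hdep : ¬ LinearIndependent R ![1, x, y] := fun h ↦ by
    have := h.cardinal_lift_le_rank
    rw [hrank] at this
    norm_num at this
  rw [Fintype.not_linearIndependent_iff] at hdep
  obtain ⟨g, hg, i, hi⟩ := hdep
  simp only [Fin.sum_univ_three, Matrix.cons_val] at hg
  by_cases h2 : g 2 = 0
  · by_cases h1 : g 1 = 0
    · have h0 : g 0 = 0 := by simpa [h1, h2] using hg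
      fin_cases i <;> contradiction
    · refine Or.inr ⟨-g 0, g 1, h1, ?_⟩
      rw [h2, zero_smul, add_zero] at hg
      rw [map_neg, Algebra.algebraMap_eq_smul_one, eq_neg_iff_add_eq_zero, add_comm, hg]
  · refine Or.inl ⟨-g 0, -g 1, g 2, h2, ?_⟩
    rw [map_neg, Algebra.algebraMap_eq_smul_one, neg_smul, ← neg_add, eq_neg_iff_add_eq_zero,
      add_comm, hg]

theorem mul_comm_of_rank_eq_two [Nontrivial S] (hrank : Module.rank R S = 2) (x y : S) :
    x * y = y * x := by
  obtain ⟨a, b, c, hc, h⟩ | ⟨a, b, hb, h⟩ :=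
    exists_smul_eq_algebraMap_add_smul_of_rank_eq_two hrank x y
  · apply smul_right_injective S hc
    simp only
    rw [← mul_smul_comm, ← smul_mul_assoc, h, mul_add, add_mul, mul_smul_comm, smul_mul_assoc,
      Algebra.commutes]
  · apply smul_right_injective S hb
    simp only
    rw [← smul_mul_assoc, ← mul_smul_comm, h, Algebra.commutes]

theorem IsStandardInvolution.apply_eq_self_of_smul_eq_algebraMap {σ : S →ₗ[R] S}
    (hσ : IsStandardInvolution R S σ) {x : S} {r s : R} (hr : r ≠ 0)
    (h : r • x = algebraMap R S s) : σ x = x := by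
  apply smul_right_injective S hr
  simp only
  rw [← map_smul, h, Algebra.algebraMap_eq_smul_one, map_smul, hσ.1]

theorem IsStandardInvolution.unique {σ τ : S →ₗ[R] S} (hσ : IsStandardInvolution R S σ)
    (hτ : IsStandardInvolution R S τ) : σ = τ := by
  ext x
  obtain ⟨t, ht⟩ := hσ.exists_add_eq_algebraMap x
  obtain ⟨u, hu⟩ := hτ.exists_add_eq_algebraMap x
  obtain ⟨m, hm⟩ := hσ.2.2.2 x
  obtain ⟨n, hn⟩ := hτ.2.2.2 x
  by_cases htu : t - u = 0
  · rw [sub_eq_zero.mp htu, ← hu] at ht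
    exact add_left_cancel ht
  · have h : (t - u) • x = algebraMap R S (m - n) := by
      rw [Algebra.smul_def, Algebra.commutes, map_sub, map_sub, ← ht, ← hu, hm, hn]
      noncomm_ring
    rw [hσ.apply_eq_self_of_smul_eq_algebraMap htu h, hτ.apply_eq_self_of_smul_eq_algebraMap htu h]

/-- In rank two, a linear form `t` with `t 1 = 2` and `x ^ 2 - t x • x ∈ R` for all `x` yields the
standard involution `x ↦ t x - x`. -/
theorem isStandardInvolution_sub_id [Nontrivial S] (hrank : Module.rank R S = 2) (t : S →ₗ[R] R)
    (h1 : t 1 = 2) (ht : ∀ x : S, ∃ n : R, x * x = t x • x - algebraMap R S n) :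
    IsStandardInvolution R S (Algebra.linearMap R S ∘ₗ t - LinearMap.id) := by
  set σ := Algebra.linearMap R S ∘ₗ t - LinearMap.id
  have hx (x : S) : σ x = algebraMap R S (t x) - x := rfl
  have hσ1 : σ 1 = 1 := by
    rw [hx, h1, map_ofNat]
    norm_num
  have hσC (r : R) : σ (algebraMap R S r) = algebraMap R S r := by
    rw [Algebra.algebraMap_eq_smul_one, map_smul, hσ1]
  have hsq (x : S) : σ (x * x) = σ x * σ x := by
    obtain ⟨n, hn⟩ := ht x
    rw [hn, map_sub, map_smul, hσC, hx, mul_sub, sub_mul, sub_mul, hn, ← Algebra.commutes (t x) x,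
      Algebra.smul_def, Algebra.smul_def, mul_sub]
    abel
  refine ⟨hσ1, fun x y ↦ ?_, fun x ↦ ?_, fun x ↦ ?_⟩
  · obtain ⟨a, b, c, hc, h⟩ | ⟨a, b, hb, h⟩ :=
      exists_smul_eq_algebraMap_add_smul_of_rank_eq_two hrank x y
    · apply smul_right_injective S hc
      simp only
      rw [← map_smul, ← mul_smul_comm, ← smul_mul_assoc, ← map_smul, h, mul_add, map_add, map_add,
        mul_smul_comm, map_smul, map_smul, hsq, hσC, add_mul, smul_mul_assoc, ← Algebra.commutes,
        ← Algebra.smul_def, ← Algebra.smul_def, map_smul]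
    · apply smul_right_injective S hb
      simp only
      rw [← map_smul, ← smul_mul_assoc, ← mul_smul_comm, ← map_smul, h, hσC, ← Algebra.commutes,
        ← Algebra.smul_def, ← Algebra.smul_def, map_smul]
  · rw [hx x, map_sub, hσC, hx]
    abel
  · obtain ⟨n, hn⟩ := ht x
    refine ⟨n, ?_⟩
    rw [hx, mul_sub, hn, ← Algebra.commutes, Algebra.smul_def]
    abel

end RankTwo

/-- Let `R` be an integrally closed noetherian domain and let `S` be an
`R`-algebra that is finitely generated projective of rank `2` as an `R`-module.  Then
`S` is commutative and has a unique standard involution. -/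
theorem quadratic_algebra_commutative_and_unique_standardInvolution
    (R S : Type*) [CommRing R] [IsDomain R] [IsNoetherianRing R] [IsIntegrallyClosed R]
    [Ring S] [Algebra R S] [Module.Finite R S] [Module.Projective R S]
    (hrank : Module.rank R S = 2) :
    (∀ x y : S, x * y = y * x) ∧ (∃! σ : S →ₗ[R] S, IsStandardInvolution R S σ) := by
  have hfin : Module.finrank R S = 2 := Module.finrank_eq_of_rank_eq (by exact_mod_cast hrank)
  have : Nontrivial S := Module.nontrivial_of_finrank_pos (R := R) (by omega)
  refine ⟨mul_comm_of_rank_eq_two hrank, ?_⟩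
  obtain ⟨t, h1, ht⟩ := exists_linearMap_one_eq_two_and_quadratic R S hfin
  have hσ := isStandardInvolution_sub_id hrank t h1 ht
  exact ⟨_, hσ, fun τ hτ ↦ hτ.unique hσ⟩
end

section
/- Let F be a field with char F ≠ 2 and let a, b ∈ F be nonzero. Then the quaternion algebra ℍ[F, a, b] is isomorphic as an F-algebra to the algebra of 2×2 matrices over F if and only if there exist x, y, z ∈ F, not all zero, with −a·x² − b·y² + a·b·z² = 0 (equivalently, the ternary quadratic form nrd restricted to the trace-zero elements is isotropic). -/
open Quaternion

namespace QuaternionAlgebra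

variable {F : Type*} [Field F] {a b : F}

/-- If the form `-a x² - b y² + a b z²` is isotropic, then `b` is a norm from `F[√a]`. -/
theorem exists_eq_sq_sub_mul_sq_of_isotropic (h2 : (2 : F) ≠ 0) (ha : a ≠ 0)
    (h : ∃ x y z : F, ¬ (x = 0 ∧ y = 0 ∧ z = 0) ∧
      -a * x ^ 2 - b * y ^ 2 + a * b * z ^ 2 = 0) :
    ∃ u v : F, u ^ 2 - a * v ^ 2 = b := by
  obtain ⟨x, y, z, hne, h⟩ := h
  by_cases hn : y ^ 2 - a * z ^ 2 = 0
  · have hx : x = 0 := by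
      have : a * x ^ 2 = 0 := by linear_combination -h - b * hn
      simpa [ha] using this
    have hz : z ≠ 0 := by
      rintro rfl
      exact hne ⟨hx, by simpa using hn, rfl⟩
    have hy : y ≠ 0 := by
      rintro rfl
      simp [ha, hz] at hn
    refine ⟨(b + 1) / 2, (b - 1) * z / (2 * y), ?_⟩
    field_simp
    linear_combination (b - 1) ^ 2 * hn
  · refine ⟨a * x * z / (y ^ 2 - a * z ^ 2), x * y / (y ^ 2 - a * z ^ 2), ?_⟩
    field_simp
    linear_combination (y ^ 2 - a * z ^ 2) * h

/-- A quaternionic basis of the `2 × 2` matrices attached to a representation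
of `b` as a norm from `F[√a]`. -/
def matrixBasis {u v : F} (h : u ^ 2 - a * v ^ 2 = b) :
    Basis (Matrix (Fin 2) (Fin 2) F) a 0 b where
  i := !![0, a; 1, 0]
  j := !![u, -(a * v); v, -u]
  k := !![a * v, -(a * u); u, -(a * v)]
  i_mul_i := by
    ext i j; fin_cases i <;> fin_cases j <;> simp
  j_mul_j := by
    subst h
    ext i j; fin_cases i <;> fin_cases j <;> simp <;> ring
  i_mul_j := by
    ext i j; fin_cases i <;> fin_cases j <;> simp
  j_mul_i := by
    ext i j; fin_cases i <;> fin_cases j <;> simp [mul_comm]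

theorem matrixBasis_liftHom_injective (h2 : (2 : F) ≠ 0) (ha : a ≠ 0) (hb : b ≠ 0) {u v : F}
    (h : u ^ 2 - a * v ^ 2 = b) : Function.Injective (matrixBasis h).liftHom := by
  rw [injective_iff_map_eq_zero]
  rintro ⟨t, x, y, z⟩ hq
  have h00 := congrFun (congrFun hq 0) 0
  have h01 := congrFun (congrFun hq 0) 1
  have h10 := congrFun (congrFun hq 1) 0
  have h11 := congrFun (congrFun hq 1) 1
  simp [Basis.lift, matrixBasis, Matrix.algebraMap_matrix_apply] at h00 h01 h10 h11
  have ht : t = 0 := mul_left_cancel₀ h2 (by linear_combination h00 + h11)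
  have hx : x = 0 := mul_left_cancel₀ (mul_ne_zero h2 ha) (by linear_combination h01 + a * h10)
  subst ht hx
  have hy : y = 0 := mul_left_cancel₀ hb (by linear_combination u * h00 - a * v * h10 - y * h)
  have hz : z = 0 := mul_left_cancel₀ hb (by linear_combination u * h10 - v * h00 - z * h)
  subst hy hz
  rfl

/-- A nonzero element of square zero is pure, hence an isotropic vector for the norm form. -/
theorem exists_isotropic_of_mul_self_eq_zero (h2 : (2 : F) ≠ 0) {q : ℍ[F, a, b]} (hq : q ≠ 0)
    (hqq : q * q = 0) :
    ∃ x y z : F, ¬ (x = 0 ∧ y = 0 ∧ z = 0) ∧ -a * x ^ 2 - b * y ^ 2 + a * b * z ^ 2 = 0 := by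
  obtain ⟨t, x, y, z⟩ := q
  rw [mk_mul_mk, QuaternionAlgebra.ext_iff] at hqq
  simp only [re_zero, imI_zero, imJ_zero, imK_zero] at hqq
  obtain ⟨hr, hi, hj, hk⟩ := hqq
  have hx : t * x = 0 := mul_left_cancel₀ h2 (by linear_combination hi)
  have hy : t * y = 0 := mul_left_cancel₀ h2 (by linear_combination hj)
  have hz : t * z = 0 := mul_left_cancel₀ h2 (by linear_combination hk)
  have ht : t = 0 := by
    by_contra ht
    obtain rfl := (mul_eq_zero.mp hx).resolve_left ht
    obtain rfl := (mul_eq_zero.mp hy).resolve_left ht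
    obtain rfl := (mul_eq_zero.mp hz).resolve_left ht
    simp [ht] at hr
  subst ht
  refine ⟨x, y, z, ?_, by linear_combination -hr⟩
  rintro ⟨rfl, rfl, rfl⟩
  exact hq rfl

end QuaternionAlgebra

/-- Let `F` be a field with `char F ≠ 2` and let `a, b ∈ F` be
nonzero.  Then `ℍ[F, a, b] ≅ M₂(F)` as `F`-algebras if and only if the ternary
quadratic form `−a·x² − b·y² + a·b·z²` (the reduced norm restricted to the trace-zero
subspace) is isotropic over `F`. -/
theorem quaternionAlgebra_isMatrixRing_iff_isotropic
    (F : Type*) [Field F] (hchar : (ringChar F) ≠ 2)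
    (a b : F) (ha : a ≠ 0) (hb : b ≠ 0) :
    Nonempty (ℍ[F, a, b] ≃ₐ[F] Matrix (Fin 2) (Fin 2) F) ↔
      ∃ x y z : F, ¬ (x = 0 ∧ y = 0 ∧ z = 0) ∧
        -a * x ^ 2 - b * y ^ 2 + a * b * z ^ 2 = 0 := by
  have h2 : (2 : F) ≠ 0 := Ring.two_ne_zero hchar
  constructor
  · rintro ⟨e⟩
    refine QuaternionAlgebra.exists_isotropic_of_mul_self_eq_zero h2
      (q := e.symm (Matrix.single 0 1 1)) ?_ ?_
    · rw [Ne, EmbeddingLike.map_eq_zero_iff]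
      intro h
      simpa using congrFun (congrFun h 0) 1
    · rw [← map_mul, Matrix.single_mul_single_of_ne _ _ _ _ (by decide), map_zero]
  · intro h
    obtain ⟨u, v, huv⟩ := QuaternionAlgebra.exists_eq_sq_sub_mul_sq_of_isotropic h2 ha h
    have hinj := QuaternionAlgebra.matrixBasis_liftHom_injective h2 ha hb huv
    have hrank : Module.finrank F ℍ[F, a, b] =
        Module.finrank F (Matrix (Fin 2) (Fin 2) F) := by
      rw [QuaternionAlgebra.finrank_eq_four, Module.finrank_matrix]
      simp
    exact ⟨AlgEquiv.ofBijective _ ⟨hinj,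
      (LinearMap.injective_iff_surjective_of_finrank_eq_finrank hrank
        (f := (QuaternionAlgebra.matrixBasis huv).liftHom.toLinearMap)).mp hinj⟩⟩
end

section
/- Let F be a field with char F ≠ 2 and let a, b, a', b' ∈ F be nonzero. Then the quaternion algebras ℍ[F, a, b] and ℍ[F, a', b'] are isomorphic as F-algebras if and only if the ternary quadratic forms ⟨−a, −b, a·b⟩ and ⟨−a', −b', a'·b'⟩ (i.e., the reduced norm forms restricted to the trace-zero subspaces) are isometric, i.e., equivalent as quadratic forms over F. -/
open Quaternion

namespace QuaternionAlgebra

variable {F : Type*} [Field F]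

/-- An algebra homomorphism from `ℍ[F, a, b]` to a nontrivial algebra is injective. -/
theorem algHom_injective {A : Type*} [Ring A] [Algebra F A] [Nontrivial A] (h2 : (2 : F) ≠ 0)
    {a b : F} (ha : a ≠ 0) (hb : b ≠ 0) (φ : ℍ[F, a, b] →ₐ[F] A) :
    Function.Injective φ := by
  have re_eq_zero : ∀ q : ℍ[F, a, b], φ q = 0 → q.re = 0 := by
    intro q hq
    have key : algebraMap F ℍ[F, a, b] (2 * 2 * a * b * q.re) =
        (a * b) • q + b • ((⟨0, 1, 0, 0⟩ : ℍ[F, a, b]) * q * ⟨0, 1, 0, 0⟩)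
          + a • ((⟨0, 0, 1, 0⟩ : ℍ[F, a, b]) * q * ⟨0, 0, 1, 0⟩)
          - (⟨0, 0, 0, 1⟩ : ℍ[F, a, b]) * q * ⟨0, 0, 0, 1⟩ := by
      ext <;> simp [algebraMap_eq] <;> ring
    have h := congrArg φ key
    simp only [map_add, map_sub, map_smul, map_mul φ, hq, mul_zero, zero_mul, smul_zero,
      add_zero, sub_zero, AlgHom.commutes] at h
    rw [FaithfulSMul.algebraMap_eq_zero_iff] at h
    simpa [h2, ha, hb] using h
  rw [injective_iff_map_eq_zero]
  intro q hq
  have mul_re (r : ℍ[F, a, b]) : (q * r).re = 0 := re_eq_zero _ (by rw [map_mul, hq, zero_mul])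
  have hi := mul_re ⟨0, 1, 0, 0⟩
  have hj := mul_re ⟨0, 0, 1, 0⟩
  have hk := mul_re ⟨0, 0, 0, 1⟩
  simp [ha, hb] at hi hj hk
  ext
  · exact re_eq_zero q hq
  · exact hi
  · exact hj
  · exact hk

/-- The inclusion of the pure quaternions into `ℍ[F, a, b]`. -/
@[simps]
def ofPure (a b : F) : (Fin 3 → F) →ₗ[F] ℍ[F, a, b] where
  toFun v := ⟨0, v 0, v 1, v 2⟩
  map_add' v w := by ext <;> simp
  map_smul' c v := by ext <;> simp

/-- The projection of `ℍ[F, a, b]` onto the pure quaternions. -/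
@[simps]
def toPure (a b : F) : ℍ[F, a, b] →ₗ[F] (Fin 3 → F) where
  toFun q := ![q.imI, q.imJ, q.imK]
  map_add' q r := by ext i; fin_cases i <;> simp
  map_smul' c q := by ext i; fin_cases i <;> simp

theorem toPure_ofPure {a b : F} (v : Fin 3 → F) : toPure a b (ofPure a b v) = v := by
  ext i; fin_cases i <;> simp

theorem ofPure_toPure {a b : F} {q : ℍ[F, a, b]} (hq : q.re = 0) :
    ofPure a b (toPure a b q) = q := by
  ext <;> simp [hq]

/-- The reduced norm form on the pure quaternions, in coordinates. -/
abbrev pureNorm (a b : F) : QuadraticForm F (Fin 3 → F) :=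
  QuadraticMap.weightedSumSquares F ![-a, -b, a * b]

theorem ofPure_mul_self {a b : F} (v : Fin 3 → F) :
    ofPure a b v * ofPure a b v = algebraMap F _ (-pureNorm a b v) := by
  ext <;> simp [algebraMap_eq, Fin.sum_univ_three] <;> ring

theorem re_map_eq_zero (h2 : (2 : F) ≠ 0) {a b a' b' : F} (φ : ℍ[F, a, b] ≃ₐ[F] ℍ[F, a', b'])
    (v : Fin 3 → F) : (φ (ofPure a b v)).re = 0 := by
  have hsq : φ (ofPure a b v) * φ (ofPure a b v) = algebraMap F _ (-pureNorm a b v) := by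
    rw [← map_mul, ofPure_mul_self, AlgEquiv.commutes]
  by_contra hre
  have hscalar : φ (ofPure a b v) = algebraMap F _ (φ (ofPure a b v)).re := by
    generalize φ (ofPure a b v) = q at hsq hre ⊢
    have hI := congrArg imI hsq
    have hJ := congrArg imJ hsq
    have hK := congrArg imK hsq
    simp only [algebraMap_eq, imI_mul, imJ_mul, imK_mul] at hI hJ hK
    have h : (2 : F) * q.re ≠ 0 := mul_ne_zero h2 hre
    ext
    · simp [algebraMap_eq]
    · exact (mul_eq_zero.mp (by linear_combination hI : 2 * q.re * q.imI = 0)).resolve_left h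
    · exact (mul_eq_zero.mp (by linear_combination hJ : 2 * q.re * q.imJ = 0)).resolve_left h
    · exact (mul_eq_zero.mp (by linear_combination hK : 2 * q.re * q.imK = 0)).resolve_left h
  rw [← AlgEquiv.commutes φ] at hscalar
  exact hre (congrArg re (φ.injective hscalar)).symm

/-- An isomorphism of quaternion algebras restricts to an isometry of pure quaternions. -/
def pureIsometryEquiv (h2 : (2 : F) ≠ 0) {a b a' b' : F}
    (φ : ℍ[F, a, b] ≃ₐ[F] ℍ[F, a', b']) :
    (pureNorm a b).IsometryEquiv (pureNorm a' b') where
  toLinearEquiv := LinearEquiv.ofLinearMap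
    (toPure a' b' ∘ₗ φ.toLinearMap ∘ₗ ofPure a b)
    (toPure a b ∘ₗ φ.symm.toLinearMap ∘ₗ ofPure a' b')
    (by
      refine LinearMap.ext fun v => ?_
      simp only [LinearMap.comp_apply, AlgEquiv.toLinearMap_apply, LinearMap.id_apply]
      rw [ofPure_toPure (re_map_eq_zero h2 φ.symm v), AlgEquiv.apply_symm_apply, toPure_ofPure])
    (by
      refine LinearMap.ext fun v => ?_
      simp only [LinearMap.comp_apply, AlgEquiv.toLinearMap_apply, LinearMap.id_apply]
      rw [ofPure_toPure (re_map_eq_zero h2 φ v), AlgEquiv.symm_apply_apply, toPure_ofPure])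
  map_app' v := by
    change pureNorm a' b' (toPure a' b' (φ (ofPure a b v))) = pureNorm a b v
    apply neg_injective
    apply (algebraMap F ℍ[F, a', b']).injective
    rw [← ofPure_mul_self, ofPure_toPure (re_map_eq_zero h2 φ v), ← map_mul, ofPure_mul_self,
      AlgEquiv.commutes]

/-- The quaternionic basis given by an isometry of the pure quaternions. -/
def basisOfIsometry {a b a' b' : F} (f : pureNorm a b →qᵢ pureNorm a' b') :
    Basis ℍ[F, a', b'] a 0 b where
  i := ofPure a' b' (f ![1, 0, 0])
  j := ofPure a' b' (f ![0, 1, 0])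
  k := ofPure a' b' (f ![1, 0, 0]) * ofPure a' b' (f ![0, 1, 0])
  i_mul_i := by
    rw [ofPure_mul_self, f.map_app, Algebra.algebraMap_eq_smul_one]
    simp [Fin.sum_univ_three]
  j_mul_j := by
    rw [ofPure_mul_self, f.map_app, Algebra.algebraMap_eq_smul_one]
    simp [Fin.sum_univ_three]
  i_mul_j := rfl
  j_mul_i := by
    have h := ofPure_mul_self (a := a') (b := b') (f (![1, 0, 0] + ![0, 1, 0]))
    have hi := ofPure_mul_self (a := a') (b := b') (f ![1, 0, 0])
    have hj := ofPure_mul_self (a := a') (b := b') (f ![0, 1, 0])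
    rw [f.map_app] at h hi hj
    rw [map_add, map_add, mul_add, add_mul, add_mul, hi, hj] at h
    have hadd : -pureNorm a b (![1, 0, 0] + ![0, 1, 0]) =
        -pureNorm a b ![1, 0, 0] + -pureNorm a b ![0, 1, 0] := by
      simp [Fin.sum_univ_three, add_comm]
    rw [hadd, map_add] at h
    rw [zero_smul, zero_sub]
    linear_combination (norm := abel) h

end QuaternionAlgebra

/-- Let `F` be a field with `char F ≠ 2` and let `a, b, a', b' ∈ F` be
nonzero.  Then `ℍ[F, a, b] ≅ ℍ[F, a', b']` as `F`-algebras if and only if the diagonal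
ternary quadratic forms `⟨−a, −b, a·b⟩` and `⟨−a', −b', a'·b'⟩` are equivalent
(isometric) over `F`. -/
theorem quaternionAlgebra_iso_iff_nrd_zero_equivalent
    (F : Type*) [Field F] (hchar : (ringChar F) ≠ 2)
    (a b a' b' : F) (ha : a ≠ 0) (hb : b ≠ 0) (ha' : a' ≠ 0) (hb' : b' ≠ 0) :
    Nonempty (ℍ[F, a, b] ≃ₐ[F] ℍ[F, a', b']) ↔
      QuadraticMap.Equivalent
        (QuadraticMap.weightedSumSquares F ![-a, -b, a * b])
        (QuadraticMap.weightedSumSquares F ![-a', -b', a' * b']) := by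
  have h2 : (2 : F) ≠ 0 := Ring.two_ne_zero hchar
  constructor
  · rintro ⟨φ⟩
    exact ⟨QuaternionAlgebra.pureIsometryEquiv h2 φ⟩
  · rintro ⟨f⟩
    let φ := (QuaternionAlgebra.basisOfIsometry f.toIsometry).liftHom
    have hinj : Function.Injective φ := QuaternionAlgebra.algHom_injective h2 ha hb φ
    have hrank : Module.finrank F ℍ[F, a, b] = Module.finrank F ℍ[F, a', b'] := by
      rw [QuaternionAlgebra.finrank_eq_four, QuaternionAlgebra.finrank_eq_four]
    have hsurj : Function.Surjective φ :=
      (LinearMap.injective_iff_surjective_of_finrank_eq_finrank (f := φ.toLinearMap) hrank).mp hinj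
    exact ⟨AlgEquiv.ofBijective φ ⟨hinj, hsurj⟩⟩
end

section
/- Let p be a prime and let D and D' be finite-dimensional associative unital ℚ_p-algebras of dimension 4 that are central simple over ℚ_p and are division rings. Then D and D' are isomorphic as ℚ_p-algebras. In other words, up to isomorphism there is a unique quaternion division algebra over ℚ_p. -/
namespace QuaternionDivision

section Algebra

variable {K D : Type*} [Field K] [DivisionRing D] [Algebra K D]

lemma coeffs_eq_zero_of_not_commute {x y : D} (h : x * y ≠ y * x) {a b : K}
    (hab : a • (1 : D) + b • x = 0) : a = 0 ∧ b = 0 := by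
  have hb : b = 0 := by
    have h1 : b • (x * y - y * x) = 0 := by
      have : (a • (1 : D) + b • x) * y - y * (a • (1 : D) + b • x) = 0 := by simp [hab]
      rw [← this]
      simp only [add_mul, mul_add, smul_mul_assoc, mul_smul_comm, one_mul, mul_one]
      module
    exact (smul_eq_zero.1 h1).resolve_right (sub_ne_zero.2 h)
  subst hb
  simpa using hab

lemma exists_mul_self_eq_of_not_commute (hdim : Module.finrank K D = 4) {x y : D}
    (h : x * y ≠ y * x) : ∃ t n : K, x * x = t • x - n • (1 : D) := by
  have : FiniteDimensional K D := .of_finrank_pos (by omega)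
  have hdep : ¬ LinearIndependent K ![1, x, x * x, y, x * y] := fun hli => by
    have := hli.fintype_card_le_finrank
    simp [hdim] at this
  obtain ⟨g, hg, i, hi⟩ := Fintype.not_linearIndependent_iff.1 hdep
  simp only [Fin.sum_univ_five, Matrix.cons_val] at hg
  have hβ : (g 3 • (1 : D) + g 4 • x) * (x * y - y * x) = 0 := by
    have : x * (g 0 • (1 : D) + g 1 • x + g 2 • (x * x) + g 3 • y + g 4 • (x * y)) -
      (g 0 • (1 : D) + g 1 • x + g 2 • (x * x) + g 3 • y + g 4 • (x * y)) * x = 0 := by simp [hg]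
    rw [← this]
    simp only [add_mul, mul_add, mul_sub, smul_mul_assoc, mul_smul_comm, one_mul, mul_one,
      mul_assoc]
    module
  obtain ⟨h3, h4⟩ := coeffs_eq_zero_of_not_commute h
    ((mul_eq_zero.1 hβ).resolve_right (sub_ne_zero.2 h))
  simp only [h3, h4, zero_smul, add_zero] at hg
  have h2 : g 2 ≠ 0 := by
    intro h2
    simp only [h2, zero_smul, add_zero] at hg
    obtain ⟨h0, h1⟩ := coeffs_eq_zero_of_not_commute h hg
    fin_cases i <;> simp_all
  refine ⟨-(g 1 / g 2), g 0 / g 2, ?_⟩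
  have : g 2 • (x * x - (-(g 1 / g 2) • x - (g 0 / g 2) • (1 : D))) = 0 := by
    rw [← hg]
    match_scalars <;> field_simp
  exact sub_eq_zero.1 ((smul_eq_zero.1 this).resolve_left h2)

lemma mul_commutator_eq {x : D} {t n : K} (hx : x * x = t • x - n • (1 : D)) (y : D) :
    x * (x * y - y * x) = (x * y - y * x) * (t • (1 : D) - x) := by
  have h1 : x * (x * y) = t • (x * y) - n • y := by
    rw [← mul_assoc, hx]; simp [sub_mul]
  simp only [mul_sub, sub_mul, mul_smul_comm, mul_one, h1, mul_assoc, hx]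
  module

lemma norm_sq_of_not_commute (hdim : Module.finrank K D = 4) {x y : D}
    (h : x * y ≠ y * x) {t n : K} (hx : x * x = t • x - n • (1 : D)) :
    Algebra.norm K x ^ 2 = n ^ 4 := by
  have hj := congrArg (Algebra.norm K) (mul_commutator_eq hx y)
  have : FiniteDimensional K D := .of_finrank_pos (by omega)
  rw [map_mul, map_mul, mul_comm] at hj
  have hj0 : Algebra.norm K (x * y - y * x) ≠ 0 :=
    ((sub_ne_zero.2 h).isUnit.map (Algebra.norm K)).ne_zero
  have hc : Algebra.norm K x = Algebra.norm K (t • (1 : D) - x) := mul_left_cancel₀ hj0 hj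
  have hn : x * (t • (1 : D) - x) = algebraMap K D n := by
    rw [mul_sub, hx, Algebra.algebraMap_eq_smul_one, mul_smul_comm, mul_one]; abel
  rw [sq]
  nth_rewrite 2 [hc]
  rw [← map_mul, hn, Algebra.norm_algebraMap, hdim]

lemma exists_norm_sq_add_smul [Algebra.IsCentral K D] (hdim : Module.finrank K D = 4) (x : D) :
    ∃ t n : K, x * x = t • x - n • (1 : D) ∧
      ∀ a : K, Algebra.norm K (x + a • (1 : D)) ^ 2 = (a ^ 2 + t * a + n) ^ 4 := by
  by_cases hc : ∃ y, x * y ≠ y * x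
  · obtain ⟨y, hy⟩ := hc
    obtain ⟨t, n, hx⟩ := exists_mul_self_eq_of_not_commute hdim hy
    refine ⟨t, n, hx, fun a => norm_sq_of_not_commute hdim (y := y) (t := t + 2 * a) ?_ ?_⟩
    · simpa [add_mul, mul_add] using hy
    · simp only [add_mul, mul_add, smul_mul_assoc, mul_smul_comm, mul_one, one_mul, hx]
      module
  · push Not at hc
    obtain ⟨b, rfl⟩ := (Algebra.IsCentral.mem_center_iff K).1
      (Subalgebra.mem_center_iff.2 fun y => (hc y).symm)
    refine ⟨2 * b, b ^ 2, ?_, fun a => ?_⟩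
    · simp only [Algebra.algebraMap_eq_smul_one, mul_smul_comm, mul_one]
      module
    · rw [← Algebra.algebraMap_eq_smul_one, ← map_add, Algebra.norm_algebraMap, hdim]
      ring

lemma exists_not_commute [Algebra.IsCentral K D] {c : K}
    (hc : ∀ b : K, b ^ 2 - b - c ≠ 0) {i : D} (hi : i * i = c • (1 : D) + i) :
    ∃ y, i * y ≠ y * i := by
  by_contra! hcom
  obtain ⟨b, rfl⟩ := (Algebra.IsCentral.mem_center_iff K).1
    (Subalgebra.mem_center_iff.2 fun y => (hcom y).symm)
  apply hc b
  apply FaithfulSMul.algebraMap_injective K D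
  rw [map_sub, map_sub, map_zero, sq, map_mul, hi, Algebra.algebraMap_eq_smul_one c]
  abel

lemma not_commute_of_conjugating {i j y : D} (hy : i * y ≠ y * i) (hj0 : j ≠ 0)
    (hji : j * i = j - i * j) : i * j ≠ j * i := by
  intro hc
  have h2 : i + i = 1 := by
    refine mul_right_cancel₀ hj0 ?_
    rw [add_mul, one_mul]
    nth_rewrite 1 [hc]
    rw [hji, sub_add_cancel]
  apply hy
  calc i * y = i * y * (i + i) := by rw [h2, mul_one]
    _ = (i + i) * (y * i) := by simp only [mul_add, add_mul, mul_assoc]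
    _ = y * i := by rw [h2, one_mul]

lemma exists_conjugating (hdim : Module.finrank K D = 4) {c : K} {i y : D}
    (hi : i * i = c • (1 : D) + i) (hy : i * y ≠ y * i) :
    ∃ (j : D) (a : K), a ≠ 0 ∧ i * j ≠ j * i ∧ j * i = j - i * j ∧ j * j = a • (1 : D) := by
  obtain ⟨j, hj0, hij⟩ : ∃ j : D, j ≠ 0 ∧ i * j = j * ((1 : K) • (1 : D) - i) :=
    ⟨i * y - y * i, sub_ne_zero.2 hy, mul_commutator_eq (n := -c) (by rw [hi]; module) y⟩
  have hji : j * i = j - i * j := by rw [hij, one_smul, mul_sub, mul_one]; abel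
  have h2 : i * j = j - j * i := by rw [hji]; abel
  have hjj : i * (j * j) = (j * j) * i := by
    rw [← mul_assoc, h2, sub_mul, mul_assoc j i j, h2, mul_sub, sub_sub_cancel, mul_assoc]
  have hjc : i * j ≠ j * i := not_commute_of_conjugating hy hj0 hji
  obtain ⟨s, m, hs⟩ := exists_mul_self_eq_of_not_commute hdim hjc.symm
  have hs0 : s = 0 := by
    rw [hs] at hjj
    have : s • (i * j - j * i) = 0 := by
      simp only [mul_sub, sub_mul, mul_smul_comm, smul_mul_assoc, mul_one, one_mul] at hjj
      rw [smul_sub, sub_eq_zero]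
      simpa using hjj
    exact (smul_eq_zero.1 this).resolve_right (sub_ne_zero.2 hjc)
  refine ⟨j, -m, ?_, hjc, hji, by rw [hs, hs0]; module⟩
  rintro hm
  rw [neg_eq_zero] at hm
  rw [hs0, hm] at hs
  exact hj0 (by simpa using hs)

lemma mul_conjugating {c a : K} {i j : D}
    (hi : i * i = c • (1 : D) + i) (hji : j * i = j - i * j) (hjj : j * j = a • (1 : D))
    (α β : K) :
    let j' := (α • (1 : D) + β • i) * j
    j' * i = j' - i * j' ∧ j' * j' = ((α ^ 2 + α * β - c * β ^ 2) * a) • (1 : D) := by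
  have h1 (z : D) : i * (i * z) = c • z + i * z := by
    rw [← mul_assoc, hi]; simp [add_mul]
  have h2 (z : D) : j * (i * z) = j * z - i * (j * z) := by
    rw [← mul_assoc, hji]; simp [sub_mul, mul_assoc]
  constructor
  · simp only [add_mul, mul_add, smul_mul_assoc, mul_smul_comm, one_mul, hji, mul_assoc, h1,
      mul_sub]
    module
  · simp only [add_mul, mul_add, smul_mul_assoc, mul_smul_comm, mul_one, one_mul, mul_assoc,
      h2, mul_sub, hjj, hi]
    module

open Quaternion in
lemma nonempty_quaternionAlgebra_equiv (hdim : Module.finrank K D = 4) {c a : K} {i j : D}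
    (hi : i * i = c • (1 : D) + i) (hij : i * j ≠ j * i) (hji : j * i = j - i * j)
    (hjj : j * j = a • (1 : D)) : Nonempty (ℍ[K, c, 1, a] ≃ₐ[K] D) := by
  have : FiniteDimensional K D := .of_finrank_pos (by omega)
  have hj0 : j ≠ 0 := by rintro rfl; simp at hij
  let q : QuaternionAlgebra.Basis D c 1 a :=
    ⟨i, j, i * j, by simpa using hi, hjj, rfl, by simpa using hji⟩
  have hinj : Function.Injective q.liftHom := by
    rw [injective_iff_map_eq_zero]
    intro z hz
    have hz : z.re • (1 : D) + z.imI • i + (z.imJ • (1 : D) + z.imK • i) * j = 0 := by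
      rw [← hz]
      simp only [QuaternionAlgebra.Basis.liftHom_apply, QuaternionAlgebra.Basis.lift, q,
        Algebra.algebraMap_eq_smul_one, add_mul, smul_mul_assoc, one_mul]
      abel
    have hβ : (z.imJ • (1 : D) + z.imK • i) * (i * j - j * i) = 0 := by
      have : i * (z.re • (1 : D) + z.imI • i + (z.imJ • (1 : D) + z.imK • i) * j) -
        (z.re • (1 : D) + z.imI • i + (z.imJ • (1 : D) + z.imK • i) * j) * i = 0 := by simp [hz]
      rw [← this]
      simp only [add_mul, mul_add, mul_sub, smul_mul_assoc, mul_smul_comm, one_mul, mul_one,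
        mul_assoc]
      module
    have hβ0 := (mul_eq_zero.1 hβ).resolve_right (sub_ne_zero.2 hij)
    rw [hβ0, zero_mul, add_zero] at hz
    obtain ⟨h0, h1⟩ := coeffs_eq_zero_of_not_commute hij hz
    obtain ⟨h2, h3⟩ := coeffs_eq_zero_of_not_commute hij hβ0
    exact QuaternionAlgebra.ext h0 h1 h2 h3
  have hsurj : Function.Surjective q.liftHom :=
    (LinearMap.injective_iff_surjective_of_finrank_eq_finrank (f := q.liftHom.toLinearMap)
      (by rw [hdim, QuaternionAlgebra.finrank_eq_four])).1 hinj
  exact ⟨AlgEquiv.ofBijective q.liftHom ⟨hinj, hsurj⟩⟩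

end Algebra

section Arithmetic

lemma exists_simple_root_zmod_two : ∀ c c' : ZMod 2, (∀ a : ZMod 2, a ^ 2 - a - c ≠ 0) →
    (∀ a : ZMod 2, a ^ 2 - a - c' ≠ 0) → ∃ a : ZMod 2,
    (1 + 4 * c') * (a ^ 2 - a) + (c' - c) = 0 ∧ (1 + 4 * c') * (2 * a - 1) ≠ 0 := by
  decide

lemma exists_norm_eq_zmod_two :
    ∀ c u : ZMod 2, u ≠ 0 → ∃ a b : ZMod 2, a ^ 2 + a * b - c * b ^ 2 = u := by
  decide

lemma trace_ne_zero_zmod_two :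
    ∀ t n : ZMod 2, (∀ a : ZMod 2, a ^ 2 + t * a + n ≠ 0) → t ≠ 0 := by
  decide

variable {p : ℕ} [Fact p.Prime]

lemma two_ne_zero_zmod (h2 : p ≠ 2) : (2 : ZMod p) ≠ 0 := by
  apply Ring.two_ne_zero
  rwa [ZMod.ringChar_zmod_n]

/-- The polynomial `X² - X - c` has no root modulo `p`. -/
def NoRootMod (c : ZMod p) : Prop := ∀ a : ZMod p, a ^ 2 - a - c ≠ 0

lemma NoRootMod.not_isSquare (h2 : p ≠ 2) {c : ZMod p} (hc : NoRootMod c) :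
    ¬ IsSquare (1 + 4 * c) := by
  rintro ⟨r, hr⟩
  have := two_ne_zero_zmod h2
  apply hc ((1 + r) / 2)
  field_simp
  linear_combination -hr

lemma exists_sq_eq_mul_of_not_isSquare {d d' : ZMod p} (hd : ¬ IsSquare d) (hd' : ¬ IsSquare d') :
    ∃ s : ZMod p, s ≠ 0 ∧ d * d' = s ^ 2 := by
  have hd0 : d ≠ 0 := by rintro rfl; exact hd (IsSquare.zero)
  have hd0' : d' ≠ 0 := by rintro rfl; exact hd' (IsSquare.zero)
  have h : quadraticChar (ZMod p) (d * d') = 1 := by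
    rw [map_mul, quadraticChar_neg_one_iff_not_isSquare.2 hd,
      quadraticChar_neg_one_iff_not_isSquare.2 hd']
    rfl
  obtain ⟨s, hs⟩ := (quadraticChar_one_iff_isSquare (mul_ne_zero hd0 hd0')).1 h
  refine ⟨s, ?_, by rw [hs, sq]⟩
  rintro rfl
  exact mul_ne_zero hd0 hd0' (by simpa using hs)

lemma NoRootMod.exists_simple_root {c c' : ZMod p} (hc : NoRootMod c) (hc' : NoRootMod c') :
    ∃ a : ZMod p, (1 + 4 * c') * (a ^ 2 - a) + (c' - c) = 0 ∧ (1 + 4 * c') * (2 * a - 1) ≠ 0 := by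
  obtain rfl | h2 := eq_or_ne p 2
  · exact exists_simple_root_zmod_two c c' hc hc'
  obtain ⟨s, hs0, hs⟩ := exists_sq_eq_mul_of_not_isSquare (hc.not_isSquare h2)
    (hc'.not_isSquare h2)
  have h20 := two_ne_zero_zmod h2
  have hd' : 1 + 4 * c' ≠ 0 := fun h => hc'.not_isSquare h2 (h ▸ IsSquare.zero)
  refine ⟨(1 + s / (1 + 4 * c')) / 2, ?_, ?_⟩
  · field_simp
    linear_combination -hs
  · field_simp
    simpa using hs0

open Polynomial in
lemma NoRootMod.exists_norm_eq {c : ZMod p} (hc : NoRootMod c) {u : ZMod p} (hu : u ≠ 0) :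
    ∃ a b : ZMod p, a ^ 2 + a * b - c * b ^ 2 = u := by
  obtain rfl | h2 := eq_or_ne p 2
  · exact exists_norm_eq_zmod_two c u hu
  have h20 := two_ne_zero_zmod h2
  have hd : 1 + 4 * c ≠ 0 := fun h => hc.not_isSquare h2 (h ▸ IsSquare.zero)
  have hodd : Fintype.card (ZMod p) % 2 = 1 := by
    rw [ZMod.card]
    exact ((Fact.out : p.Prime).eq_two_or_odd).resolve_left h2
  obtain ⟨a, b, hab⟩ := FiniteField.exists_root_sum_quadratic
    (f := X ^ 2 - C u) (g := C (-(1 + 4 * c)) * X ^ 2)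
    (degree_X_pow_sub_C (by decide) _) (degree_C_mul_X_pow 2 (neg_ne_zero.2 hd)) hodd
  simp only [eval_sub, eval_pow, eval_X, eval_C, eval_mul] at hab
  exact ⟨a - b, 2 * b, by linear_combination hab⟩

lemma toZMod_eq_zero_iff {z : ℤ_[p]} : PadicInt.toZMod z = 0 ↔ ‖z‖ < 1 := by
  rw [← PadicInt.mem_nonunits, ← IsLocalRing.mem_maximalIdeal, ← PadicInt.ker_toZMod,
    RingHom.mem_ker]

lemma norm_eq_one_of_toZMod_ne_zero {z : ℤ_[p]} (hz : PadicInt.toZMod z ≠ 0) : ‖z‖ = 1 :=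
  le_antisymm z.norm_le_one (not_lt.1 fun h => hz (toZMod_eq_zero_iff.2 h))

open Polynomial in
lemma exists_root_of_simple_root_mod {A B C : ℤ_[p]} {a : ZMod p}
    (h0 : PadicInt.toZMod A * a ^ 2 + PadicInt.toZMod B * a + PadicInt.toZMod C = 0)
    (h1 : 2 * PadicInt.toZMod A * a + PadicInt.toZMod B ≠ 0) :
    ∃ z : ℤ_[p], A * z ^ 2 + B * z + C = 0 := by
  obtain ⟨a, rfl⟩ := ZMod.ringHom_surjective (PadicInt.toZMod (p := p)) a
  have hd : ‖2 * A * a + B‖ = 1 :=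
    norm_eq_one_of_toZMod_ne_zero (by simpa [map_ofNat] using h1)
  have hv : ‖A * a ^ 2 + B * a + C‖ < 1 :=
    toZMod_eq_zero_iff.1 (by simpa using h0)
  obtain ⟨z, hz, -⟩ := hensels_lemma (p := p) (R := ℤ_[p])
    (F := Polynomial.C A * X ^ 2 + Polynomial.C B * X + Polynomial.C C) (a := a) (by
      have e : (aeval a) (derivative (Polynomial.C A * X ^ 2 + Polynomial.C B * X +
          Polynomial.C C)) = 2 * A * a + B := by
        simp
        ring
      rw [e, hd]
      simpa using hv)
  exact ⟨z, by simpa using hz⟩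

lemma exists_change_generator {c c' : ℤ_[p]} (hc : NoRootMod (PadicInt.toZMod c))
    (hc' : NoRootMod (PadicInt.toZMod c')) :
    ∃ a : ℤ_[p], (1 + 4 * c') * (a ^ 2 - a) + (c' - c) = 0 := by
  obtain ⟨a, h0, h1⟩ := hc.exists_simple_root hc'
  obtain ⟨z, hz⟩ := exists_root_of_simple_root_mod
    (A := 1 + 4 * c') (B := -(1 + 4 * c')) (C := c' - c) (a := a)
    (by
      simp only [map_add, map_mul, map_sub, map_neg, map_one, map_ofNat]
      linear_combination h0)
    (by
      simp only [map_add, map_mul, map_neg, map_one, map_ofNat]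
      contrapose! h1
      linear_combination h1)
  exact ⟨z, by linear_combination hz⟩

lemma exists_norm_eq_unit {c : ℤ_[p]} (hc : NoRootMod (PadicInt.toZMod c)) {u : ℤ_[p]}
    (hu : ‖u‖ = 1) : ∃ a b : ℤ_[p], a ^ 2 + a * b - c * b ^ 2 = u := by
  have hu0 : PadicInt.toZMod u ≠ 0 := fun h => (toZMod_eq_zero_iff.1 h).ne hu
  obtain ⟨a, b, hab⟩ := hc.exists_norm_eq hu0
  obtain ⟨a', rfl⟩ := ZMod.ringHom_surjective (PadicInt.toZMod (p := p)) a
  obtain ⟨b', rfl⟩ := ZMod.ringHom_surjective (PadicInt.toZMod (p := p)) b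
  by_cases h : 2 * PadicInt.toZMod a' + PadicInt.toZMod b' = 0
  · obtain ⟨z, hz⟩ := exists_root_of_simple_root_mod
      (A := -c) (B := a') (C := a' ^ 2 - u) (a := PadicInt.toZMod b')
      (by
        simp only [map_neg, map_sub, map_pow]
        linear_combination hab)
      (by
        simp only [map_neg]
        intro h'
        apply hu0
        have h2 : 2 * PadicInt.toZMod u = 0 := by
          linear_combination -2 * hab + PadicInt.toZMod a' * h + PadicInt.toZMod b' * h'
        obtain h20 | h := mul_eq_zero.1 h2
        · have hb : PadicInt.toZMod b' = 0 := by
            linear_combination h - PadicInt.toZMod a' * h20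
          have ha : PadicInt.toZMod a' = 0 := by
            linear_combination h' + 2 * PadicInt.toZMod c * hb
          rw [← hab, ha, hb]; ring
        · exact h)
    exact ⟨a', z, by linear_combination hz⟩
  · obtain ⟨z, hz⟩ := exists_root_of_simple_root_mod
      (A := 1) (B := b') (C := -c * b' ^ 2 - u) (a := PadicInt.toZMod a')
      (by
        simp only [map_neg, map_sub, map_pow, map_mul, map_one]
        linear_combination hab)
      (by simpa using h)
    exact ⟨z, b', by linear_combination hz⟩

lemma no_root_of_noRootMod {c : ℤ_[p]} (hc : NoRootMod (PadicInt.toZMod c)) (b : ℚ_[p]) :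
    b ^ 2 - b - c ≠ 0 := by
  intro h
  have hb : ‖b‖ ≤ 1 := by
    by_contra! hb
    have h1 : ‖b‖ ^ 2 ≤ max ‖b‖ ‖(c : ℚ_[p])‖ := by
      rw [← norm_pow, show b ^ 2 = b + c by linear_combination h]
      exact Padic.nonarchimedean _ _
    have hc1 : ‖(c : ℚ_[p])‖ ≤ 1 := c.2
    rw [max_eq_left (hc1.trans hb.le)] at h1
    nlinarith
  obtain ⟨b, rfl⟩ : ∃ b' : ℤ_[p], (b' : ℚ_[p]) = b := ⟨⟨b, hb⟩, rfl⟩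
  apply hc (PadicInt.toZMod b)
  rw [← map_pow, ← map_sub, ← map_sub]
  have : b ^ 2 - b - c = 0 := Subtype.coe_injective (by simpa using h)
  rw [this, map_zero]

lemma exists_root_of_one_lt_norm {t n : ℚ_[p]} (hn : ‖n‖ ≤ 1) (ht : 1 < ‖t‖) :
    ∃ r : ℚ_[p], r ^ 2 - t * r + n = 0 := by
  have ht0 : t ≠ 0 := norm_pos_iff.1 (by linarith)
  have hnt : ‖n / t ^ 2‖ < 1 := by
    rw [norm_div, norm_pow, div_lt_one (by positivity)]
    nlinarith
  obtain ⟨m, hm⟩ : ∃ m : ℤ_[p], (m : ℚ_[p]) = n / t ^ 2 := ⟨⟨_, hnt.le⟩, rfl⟩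
  rw [← hm, PadicInt.padic_norm_e_of_padicInt] at hnt
  obtain ⟨z, hz⟩ := exists_root_of_simple_root_mod (A := 1) (B := -1) (C := m) (a := 0)
    (by simpa using toZMod_eq_zero_iff.2 hnt) (by simp)
  refine ⟨t * z, ?_⟩
  have hz' : (z : ℚ_[p]) ^ 2 - z + n / t ^ 2 = 0 := by
    rw [← hm]
    have : z ^ 2 - z + m = 0 := by linear_combination hz
    simpa using congrArg ((↑) : ℤ_[p] → ℚ_[p]) this
  field_simp at hz'
  linear_combination hz'

lemma exists_eq_zpow_mul_unit {a : ℚ_[p]} (ha : a ≠ 0) :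
    ∃ (m : ℤ) (u : ℤ_[p]), ‖u‖ = 1 ∧ a * u = (p : ℚ_[p]) ^ m := by
  have hp : (p : ℚ_[p]) ≠ 0 := by exact_mod_cast (Fact.out : p.Prime).ne_zero
  have hpp : (p : ℝ) ≠ 0 := by exact_mod_cast (Fact.out : p.Prime).ne_zero
  have hu : ‖(p : ℚ_[p]) ^ a.valuation / a‖ = 1 := by
    rw [norm_div, Padic.norm_p_zpow, Padic.norm_eq_zpow_neg_valuation ha, div_self]
    positivity
  exact ⟨a.valuation, ⟨_, hu.le⟩, hu, mul_div_cancel₀ _ ha⟩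

lemma exists_mul_add_two_mul_eq_one {t n : ℤ_[p]}
    (h : ∀ a : ZMod p, a ^ 2 + PadicInt.toZMod t * a + PadicInt.toZMod n ≠ 0) :
    ∃ r s : ℤ_[p], PadicInt.toZMod r ≠ 0 ∧ r * t + 2 * s = 1 := by
  obtain rfl | h2 := eq_or_ne p 2
  · have ht : PadicInt.toZMod t ≠ 0 := trace_ne_zero_zmod_two _ _ h
    obtain ⟨r, hr⟩ := (PadicInt.isUnit_iff.2 (norm_eq_one_of_toZMod_ne_zero ht)).exists_left_inv
    refine ⟨r, 0, fun h0 => ?_, by simpa using hr⟩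
    have := congrArg PadicInt.toZMod hr
    rw [map_mul, h0, zero_mul, map_one] at this
    exact zero_ne_one this
  · have h20 : PadicInt.toZMod (2 : ℤ_[p]) ≠ 0 := by
      rw [map_ofNat]
      exact two_ne_zero_zmod h2
    obtain ⟨r, hr⟩ := (PadicInt.isUnit_iff.2 (norm_eq_one_of_toZMod_ne_zero h20)).exists_left_inv
    exact ⟨1, r * (1 - t), by simp, by linear_combination (1 - t) * hr⟩

lemma exists_noRootMod_of_trace_norm {t n : ℤ_[p]}
    (h : ∀ a : ZMod p, a ^ 2 + PadicInt.toZMod t * a + PadicInt.toZMod n ≠ 0) :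
    ∃ r s : ℤ_[p], r * t + 2 * s = 1 ∧
      NoRootMod (PadicInt.toZMod (-(s ^ 2 + r * t * s + r ^ 2 * n))) := by
  obtain ⟨r, s, hr, hrs⟩ := exists_mul_add_two_mul_eq_one h
  refine ⟨r, s, hrs, fun a ha => h ((PadicInt.toZMod s - a) / PadicInt.toZMod r) ?_⟩
  have hrs' := congrArg PadicInt.toZMod hrs
  simp only [map_add, map_mul, map_one, map_ofNat, map_neg, map_pow] at hrs' ha
  field_simp
  linear_combination ha - a * hrs'

end Arithmetic

section Padic

variable {p : ℕ} [Fact p.Prime] {D : Type*} [DivisionRing D] [Algebra ℚ_[p] D]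

variable (p D) in
/-- The `p`-adic absolute value of the norm of an element of a `ℚ_[p]`-algebra. -/
noncomputable def absNorm : D →* ℝ :=
  (normHom (α := ℚ_[p]) : ℚ_[p] →* ℝ).comp (Algebra.norm ℚ_[p])

lemma absNorm_nonneg (x : D) : 0 ≤ absNorm p D x := norm_nonneg (Algebra.norm ℚ_[p] x)

lemma absNorm_pos {x : D} (hx : x ≠ 0) : 0 < absNorm p D x :=
  norm_pos_iff.2 (hx.isUnit.map (Algebra.norm ℚ_[p])).ne_zero

lemma absNorm_algebraMap (hdim : Module.finrank ℚ_[p] D = 4) (a : ℚ_[p]) :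
    absNorm p D (algebraMap ℚ_[p] D a) = ‖a‖ ^ 4 := by
  have : absNorm p D (algebraMap ℚ_[p] D a) = ‖Algebra.norm ℚ_[p] (algebraMap ℚ_[p] D a)‖ := rfl
  rw [this, Algebra.norm_algebraMap, hdim, norm_pow]

lemma absNorm_zero (hdim : Module.finrank ℚ_[p] D = 4) : absNorm p D 0 = 0 := by
  simpa using absNorm_algebraMap hdim 0

lemma absNorm_inv_mul {x y : D} (hy : y ≠ 0) :
    absNorm p D (y⁻¹ * x) = absNorm p D x / absNorm p D y := by
  rw [eq_div_iff (absNorm_pos hy).ne', mul_comm, ← map_mul, mul_inv_cancel_left₀ hy]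

lemma exists_absNorm_add_smul [Algebra.IsCentral ℚ_[p] D] (hdim : Module.finrank ℚ_[p] D = 4)
    (x : D) : ∃ t n : ℚ_[p], x * x = t • x - n • (1 : D) ∧
      ∀ a : ℚ_[p], absNorm p D (x + a • (1 : D)) = ‖a ^ 2 + t * a + n‖ ^ 2 := by
  obtain ⟨t, n, hx, h⟩ := exists_norm_sq_add_smul hdim x
  refine ⟨t, n, hx, fun a => ?_⟩
  have := congrArg norm (h a)
  rw [norm_pow, norm_pow, pow_mul _ 2 2] at this
  exact (pow_left_inj₀ (absNorm_nonneg _) (by positivity) two_ne_zero).1 this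

lemma absNorm_add_one_le [Algebra.IsCentral ℚ_[p] D] (hdim : Module.finrank ℚ_[p] D = 4)
    {x : D} (hx : absNorm p D x ≤ 1) : absNorm p D (x + 1) ≤ 1 := by
  obtain ⟨t, n, -, h⟩ := exists_absNorm_add_smul hdim x
  have hn : ‖n‖ ≤ 1 := by
    have h0 := h 0
    simp only [zero_smul, add_zero, ne_eq, OfNat.ofNat_ne_zero, not_false_eq_true, zero_pow,
      mul_zero, zero_add] at h0
    rw [h0] at hx
    exact (sq_le_one_iff₀ (norm_nonneg n)).1 hx
  by_cases ht : ‖t‖ ≤ 1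
  · have h1 := h 1
    rw [one_smul] at h1
    rw [h1]
    refine pow_le_one₀ (norm_nonneg _) ?_
    refine (Padic.nonarchimedean _ _).trans (max_le ((Padic.nonarchimedean _ _).trans ?_) hn)
    simpa using ht
  · obtain ⟨r, hr⟩ := exists_root_of_one_lt_norm hn (not_le.1 ht)
    have hxr : x = algebraMap ℚ_[p] D r := by
      by_contra hne
      have h1 := absNorm_pos (p := p) (sub_ne_zero.2 hne)
      have h2 := h (-r)
      rw [show (-r) ^ 2 + t * (-r) + n = 0 by linear_combination hr, neg_smul,
        ← sub_eq_add_neg, ← Algebra.algebraMap_eq_smul_one] at h2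
      rw [h2] at h1
      simp at h1
    rw [hxr, absNorm_algebraMap hdim] at hx
    rw [hxr, ← map_one (algebraMap ℚ_[p] D), ← map_add, absNorm_algebraMap hdim]
    have hr1 : ‖r‖ ≤ 1 := (pow_le_one_iff_of_nonneg (norm_nonneg r) (by norm_num)).1 hx
    exact pow_le_one₀ (norm_nonneg _)
      ((Padic.nonarchimedean _ _).trans (max_le hr1 (by simp)))

/-- The elements of `p`-adically integral norm form a subring. -/
noncomputable def integers [Algebra.IsCentral ℚ_[p] D] (hdim : Module.finrank ℚ_[p] D = 4) :
    Subring D where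
  carrier := {x | absNorm p D x ≤ 1}
  mul_mem' {x y} hx hy := by
    simp only [Set.mem_ofPred_eq, map_mul] at *
    exact mul_le_one₀ hx (absNorm_nonneg y) hy
  one_mem' := by simp
  zero_mem' := by simp [absNorm_zero hdim]
  neg_mem' {x} hx := by
    have h1 : absNorm p D (-1) = 1 := by
      simpa using absNorm_algebraMap hdim (-1)
    simp only [Set.mem_ofPred_eq] at *
    rwa [← neg_one_mul, map_mul, h1, one_mul]
  add_mem' {x y} hx hy := by
    simp only [Set.mem_ofPred_eq] at *
    have key : ∀ {x y : D}, absNorm p D x ≤ absNorm p D y → absNorm p D y ≤ 1 →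
        absNorm p D (x + y) ≤ 1 := by
      intro x y hxy hy
      obtain rfl | hy0 := eq_or_ne y 0
      · simpa using hxy.trans hy
      have h1 : absNorm p D (y⁻¹ * x) ≤ 1 := by
        rw [absNorm_inv_mul hy0]
        exact div_le_one_of_le₀ hxy (absNorm_nonneg y)
      have h2 : x + y = y * (y⁻¹ * x + 1) := by rw [mul_add, mul_inv_cancel_left₀ hy0, mul_one]
      rw [h2, map_mul]
      exact mul_le_one₀ hy (absNorm_nonneg _) (absNorm_add_one_le hdim h1)
    obtain h | h := le_total (absNorm p D x) (absNorm p D y)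
    · exact key h hy
    · rw [add_comm]; exact key h hx

lemma mem_integers [Algebra.IsCentral ℚ_[p] D] {hdim : Module.finrank ℚ_[p] D = 4} {x : D} :
    x ∈ integers hdim ↔ absNorm p D x ≤ 1 := Iff.rfl

lemma smul_one_mem_integers [Algebra.IsCentral ℚ_[p] D] (hdim : Module.finrank ℚ_[p] D = 4)
    (a : ℤ_[p]) : (a : ℚ_[p]) • (1 : D) ∈ integers hdim := by
  rw [mem_integers, ← Algebra.algebraMap_eq_smul_one, absNorm_algebraMap hdim]
  exact pow_le_one₀ (norm_nonneg _) a.2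

/-- An element of maximal norm among those of norm less than `1`. -/
lemma exists_uniformizer [Algebra.IsCentral ℚ_[p] D] (hdim : Module.finrank ℚ_[p] D = 4) :
    ∃ π : D, π ≠ 0 ∧ absNorm p D π ≤ ((p : ℝ)⁻¹) ^ 2 ∧
      ∀ y : D, absNorm p D y < 1 → absNorm p D y ≤ absNorm p D π := by
  have hp0 : (p : ℝ)⁻¹ > 0 := by
    have := (Fact.out : p.Prime).pos
    positivity
  have hp1 : (p : ℝ)⁻¹ < 1 := inv_lt_one_of_one_lt₀ (by exact_mod_cast (Fact.out : p.Prime).one_lt)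
  have hstep (k : ℤ) (n : ℚ_[p]) (h : ‖n‖ < (p : ℝ) ^ (k + 1)) : ‖n‖ ≤ (p : ℝ) ^ k :=
    (Padic.norm_le_pow_iff_norm_lt_pow_add_one n k).2 h
  have hval (y : D) (hy : absNorm p D y < 1) :
      ∃ n : ℚ_[p], absNorm p D y = ‖n‖ ^ 2 ∧ ‖n‖ ≤ (p : ℝ)⁻¹ := by
    obtain ⟨t, n, -, h⟩ := exists_absNorm_add_smul hdim y
    have h0 := h 0
    simp only [zero_smul, add_zero, ne_eq, OfNat.ofNat_ne_zero, not_false_eq_true, zero_pow,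
      mul_zero, zero_add] at h0
    refine ⟨n, h0, ?_⟩
    rw [h0] at hy
    simpa using hstep (-1) n (by simpa using (sq_lt_one_iff₀ (norm_nonneg n)).1 hy)
  by_cases hπ : ∃ π : D, absNorm p D π = ((p : ℝ)⁻¹) ^ 2
  · obtain ⟨π, hπ⟩ := hπ
    refine ⟨π, ?_, hπ.le, fun y hy => ?_⟩
    · rintro rfl
      rw [absNorm_zero hdim] at hπ
      exact (pow_pos hp0 2).ne hπ
    · obtain ⟨n, hn, hn'⟩ := hval y hy
      rw [hn, hπ]
      gcongr
  · have hpD : absNorm p D (algebraMap ℚ_[p] D p) = ((p : ℝ)⁻¹) ^ 4 := by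
      rw [absNorm_algebraMap hdim, Padic.norm_p]
    refine ⟨algebraMap ℚ_[p] D p, ?_, ?_, fun y hy => ?_⟩
    · intro h0
      rw [h0, absNorm_zero hdim] at hpD
      exact (pow_pos hp0 4).ne hpD
    · rw [hpD]
      exact pow_le_pow_of_le_one hp0.le hp1.le (by norm_num)
    · obtain ⟨n, hn, hn'⟩ := hval y hy
      have hlt : ‖n‖ < (p : ℝ)⁻¹ := hn'.lt_of_ne fun h => hπ ⟨y, by rw [hn, h]⟩
      have := hstep (-2) n (by simpa using hlt)
      rw [hn, hpD, show 4 = 2 * 2 by norm_num, pow_mul]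
      gcongr
      simpa [zpow_neg] using this

lemma exists_eq_add_pow_smul [Algebra.IsCentral ℚ_[p] D] (hdim : Module.finrank ℚ_[p] D = 4)
    (hres : ∀ x ∈ integers hdim, ∃ a : ℤ_[p], absNorm p D (x - (a : ℚ_[p]) • (1 : D)) < 1) :
    ∃ π : D, ∀ m : ℕ, ∀ x ∈ integers hdim, ∃ (a b : ℚ_[p]), ∃ y ∈ integers hdim,
      x = a • (1 : D) + b • π + ((p : ℚ_[p]) ^ m) • y := by
  obtain ⟨π, hπ0, hπ, hmax⟩ := exists_uniformizer hdim
  have hp0 : (p : ℚ_[p]) ≠ 0 := by exact_mod_cast (Fact.out : p.Prime).ne_zero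
  have hstep (x : D) (hx : x ∈ integers hdim) :
      ∃ (a : ℤ_[p]), ∃ y ∈ integers hdim, x = (a : ℚ_[p]) • (1 : D) + π * y := by
    obtain ⟨a, ha⟩ := hres x hx
    refine ⟨a, π⁻¹ * (x - (a : ℚ_[p]) • (1 : D)), ?_, ?_⟩
    · rw [mem_integers, absNorm_inv_mul hπ0]
      exact div_le_one_of_le₀ (hmax _ ha) (absNorm_nonneg _)
    · rw [mul_inv_cancel_left₀ hπ0]; abel
  have hππ : (p : ℚ_[p])⁻¹ • (π * π) ∈ integers hdim := by
    have hp := (Fact.out : p.Prime).pos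
    rw [mem_integers, Algebra.smul_def, map_mul, map_mul, absNorm_algebraMap hdim, norm_inv,
      Padic.norm_p, inv_inv]
    calc (p : ℝ) ^ 4 * (absNorm p D π * absNorm p D π)
        ≤ (p : ℝ) ^ 4 * (((p : ℝ)⁻¹) ^ 2 * ((p : ℝ)⁻¹) ^ 2) := by
          gcongr
          exact absNorm_nonneg _
      _ = 1 := by field_simp
  refine ⟨π, fun m => ?_⟩
  induction m with
  | zero => exact fun x hx => ⟨0, 0, x, hx, by simp⟩
  | succ m ih =>
    intro x hx
    obtain ⟨a, b, y, hy, rfl⟩ := ih x hx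
    obtain ⟨a₁, y₁, hy₁, rfl⟩ := hstep y hy
    obtain ⟨a₂, y₂, hy₂, rfl⟩ := hstep y₁ hy₁
    refine ⟨a + p ^ m * a₁, b + p ^ m * a₂, _, mul_mem hππ hy₂, ?_⟩
    simp only [mul_add, mul_smul_comm, smul_mul_assoc, mul_one, mul_assoc]
    match_scalars <;> field_simp
    ring

/-- The residue ring of the integers of `D` is larger than the prime field. -/
lemma exists_absNorm_add_eq_one [Algebra.IsCentral ℚ_[p] D] (hdim : Module.finrank ℚ_[p] D = 4) :
    ∃ x ∈ integers hdim, ∀ a : ℤ_[p], absNorm p D (x + (a : ℚ_[p]) • (1 : D)) = 1 := by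
  by_contra! hcon
  have hres : ∀ x ∈ integers hdim,
      ∃ a : ℤ_[p], absNorm p D (x - (a : ℚ_[p]) • (1 : D)) < 1 := by
    intro x hx
    obtain ⟨a, ha⟩ := hcon x hx
    refine ⟨-a, lt_of_le_of_ne ?_ ?_⟩
    · exact sub_mem hx (smul_one_mem_integers hdim _)
    · simpa [sub_neg_eq_add] using ha
  obtain ⟨π, hπ⟩ := exists_eq_add_pow_smul hdim hres
  have hp1 : (p : ℝ)⁻¹ < 1 := inv_lt_one_of_one_lt₀ (by exact_mod_cast (Fact.out : p.Prime).one_lt)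
  have hint (w w' : D) (hw : w ∈ integers hdim) (hw' : w' ∈ integers hdim) : w * w' = w' * w := by
    by_contra hne
    have hle (m : ℕ) : absNorm p D (w * w' - w' * w) ≤ (((p : ℝ)⁻¹) ^ 4) ^ m := by
      obtain ⟨a, b, y, hy, hwy⟩ := hπ m w hw
      obtain ⟨a', b', y', hy', hwy'⟩ := hπ m w' hw'
      have hmem : (w * y' - y' * w) + (y * w' - w' * y) -
          ((p : ℚ_[p]) ^ m) • (y * y' - y' * y) ∈ integers hdim := by
        have hpm : ((p : ℚ_[p]) ^ m) • (1 : D) ∈ integers hdim := by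
          simpa using smul_one_mem_integers hdim ((p : ℤ_[p]) ^ m)
        rw [← one_mul (y * y' - y' * y), ← smul_mul_assoc]
        exact sub_mem (add_mem (sub_mem (mul_mem hw hy') (mul_mem hy' hw))
          (sub_mem (mul_mem hy hw') (mul_mem hw' hy)))
          (mul_mem hpm (sub_mem (mul_mem hy hy') (mul_mem hy' hy)))
      have heq : w * w' - w' * w = ((p : ℚ_[p]) ^ m) • ((w * y' - y' * w) + (y * w' - w' * y) -
          ((p : ℚ_[p]) ^ m) • (y * y' - y' * y)) := by
        rw [hwy, hwy']
        simp only [mul_add, add_mul, mul_smul_comm, smul_mul_assoc, mul_one, one_mul]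
        module
      rw [heq, Algebra.smul_def, map_mul, absNorm_algebraMap hdim, norm_pow, Padic.norm_p,
        ← pow_mul, mul_comm m 4, pow_mul]
      exact mul_le_of_le_one_right (by positivity) hmem
    have hpos := absNorm_pos (p := p) (sub_ne_zero.2 hne)
    obtain ⟨m, hm⟩ := exists_pow_lt_of_lt_one hpos
      (pow_lt_one₀ (by positivity) hp1 (by norm_num : 4 ≠ 0))
    exact (hle m).not_gt hm
  have hcomm (w w' : D) : w * w' = w' * w := by
    have hscale (w : D) : ∃ m : ℕ, ((p : ℚ_[p]) ^ m) • w ∈ integers hdim := by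
      have hp4 : ((p : ℝ)⁻¹) ^ 4 < 1 := pow_lt_one₀ (by positivity) hp1 (by norm_num : 4 ≠ 0)
      obtain rfl | hw := eq_or_ne w 0
      · exact ⟨0, by simp⟩
      obtain ⟨m, hm⟩ := exists_pow_lt_of_lt_one (inv_pos.2 (absNorm_pos (p := p) hw)) hp4
      refine ⟨m, ?_⟩
      rw [mem_integers, Algebra.smul_def, map_mul, absNorm_algebraMap hdim, norm_pow,
        Padic.norm_p, ← pow_mul, mul_comm m 4, pow_mul]
      calc _ ≤ (absNorm p D w)⁻¹ * absNorm p D w := by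
            gcongr
            exact absNorm_nonneg _
        _ = 1 := inv_mul_cancel₀ (absNorm_pos hw).ne'
    obtain ⟨m, hm⟩ := hscale w
    obtain ⟨m', hm'⟩ := hscale w'
    have h := hint _ _ hm hm'
    have hp0 : (p : ℚ_[p]) ≠ 0 := by exact_mod_cast (Fact.out : p.Prime).ne_zero
    rw [smul_mul_smul_comm, smul_mul_smul_comm, mul_comm (_ ^ m')] at h
    exact smul_right_injective D (mul_ne_zero (pow_ne_zero m hp0) (pow_ne_zero m' hp0)) h
  have hbot : (⊥ : Subalgebra ℚ_[p] D) = ⊤ := by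
    rw [← Algebra.IsCentral.center_eq_bot, eq_top_iff]
    exact fun x _ => Subalgebra.mem_center_iff.2 fun y => hcomm y x
  have := Subalgebra.bot_eq_top_iff_finrank_eq_one.1 hbot
  omega

lemma exists_generator [Algebra.IsCentral ℚ_[p] D] (hdim : Module.finrank ℚ_[p] D = 4) :
    ∃ (c : ℤ_[p]) (i : D), NoRootMod (PadicInt.toZMod c) ∧ i * i = (c : ℚ_[p]) • (1 : D) + i := by
  obtain ⟨x, hx, hx1⟩ := exists_absNorm_add_eq_one hdim
  obtain ⟨t, n, hxx, h⟩ := exists_absNorm_add_smul hdim x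
  have h1 (a : ℤ_[p]) : ‖(a : ℚ_[p]) ^ 2 + t * a + n‖ = 1 :=
    (pow_eq_one_iff_of_nonneg (norm_nonneg _) two_ne_zero).1 (by rw [← h, hx1])
  have hn : ‖n‖ ≤ 1 := by simpa using (h1 0).le
  have ht : ‖t‖ ≤ 1 := by
    have h2 : ‖1 + t + n‖ ≤ 1 := by simpa using (h1 1).le
    rw [show t = (1 + t + n) + -(1 + n) by ring]
    refine (Padic.nonarchimedean _ _).trans (max_le h2 ?_)
    rw [norm_neg]
    exact (Padic.nonarchimedean _ _).trans (max_le (by simp) hn)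
  obtain ⟨t, rfl⟩ : ∃ t' : ℤ_[p], (t' : ℚ_[p]) = t := ⟨⟨t, ht⟩, rfl⟩
  obtain ⟨n, rfl⟩ : ∃ n' : ℤ_[p], (n' : ℚ_[p]) = n := ⟨⟨n, hn⟩, rfl⟩
  obtain ⟨r, s, hrs, hc⟩ := exists_noRootMod_of_trace_norm (t := t) (n := n) (by
    intro a ha
    obtain ⟨a, rfl⟩ := ZMod.ringHom_surjective (PadicInt.toZMod (p := p)) a
    rw [← map_pow, ← map_mul, ← map_add, ← map_add, toZMod_eq_zero_iff,
      ← PadicInt.padic_norm_e_of_padicInt] at ha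
    push_cast at ha
    exact ha.ne (h1 a))
  refine ⟨_, (r : ℚ_[p]) • x + (s : ℚ_[p]) • (1 : D), hc, ?_⟩
  have hrs' : (r : ℚ_[p]) * t + 2 * s = 1 := by exact_mod_cast congrArg ((↑) : ℤ_[p] → ℚ_[p]) hrs
  simp only [mul_add, add_mul, mul_smul_comm, smul_mul_assoc, mul_one, one_mul, hxx]
  push_cast
  match_scalars
  · linear_combination (r : ℚ_[p]) * hrs'
  · linear_combination (s : ℚ_[p]) * hrs'

lemma exists_generator_of_noRootMod [Algebra.IsCentral ℚ_[p] D]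
    (hdim : Module.finrank ℚ_[p] D = 4) {c : ℤ_[p]} (hc : NoRootMod (PadicInt.toZMod c)) :
    ∃ i : D, i * i = (c : ℚ_[p]) • (1 : D) + i := by
  obtain ⟨c', i, hc', hi⟩ := exists_generator hdim
  obtain ⟨a, ha⟩ := exists_change_generator hc hc'
  have ha' : (1 + 4 * (c' : ℚ_[p])) * ((a : ℚ_[p]) ^ 2 - a) + (c' - c) = 0 := by
    exact_mod_cast congrArg ((↑) : ℤ_[p] → ℚ_[p]) ha
  refine ⟨(a : ℚ_[p]) • (1 : D) + (1 - 2 * a : ℚ_[p]) • i, ?_⟩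
  simp only [mul_add, add_mul, mul_smul_comm, smul_mul_assoc, mul_one, one_mul, hi]
  match_scalars
  · linear_combination ha'
  · ring

open Quaternion in
/-- A quaternion division algebra over `ℚ_[p]` is the cyclic algebra given by the unramified
quadratic extension and the uniformizer `p`. -/
lemma nonempty_quaternionAlgebra_equiv_of_noRootMod [Algebra.IsCentral ℚ_[p] D]
    (hdim : Module.finrank ℚ_[p] D = 4) {c : ℤ_[p]} (hc : NoRootMod (PadicInt.toZMod c)) :
    Nonempty (ℍ[ℚ_[p], c, 1, p] ≃ₐ[ℚ_[p]] D) := by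
  obtain ⟨i, hi⟩ := exists_generator_of_noRootMod hdim hc
  obtain ⟨y, hy⟩ := exists_not_commute (no_root_of_noRootMod hc) hi
  obtain ⟨j, a, ha, hij, hji, hjj⟩ := exists_conjugating hdim hi hy
  obtain ⟨m, u, hu, hau⟩ := exists_eq_zpow_mul_unit ha
  obtain ⟨α, β, hαβ⟩ := exists_norm_eq_unit hc hu
  have hαβ' : (α : ℚ_[p]) ^ 2 + α * β - c * β ^ 2 = u := by
    simpa using congrArg ((↑) : ℤ_[p] → ℚ_[p]) hαβ
  have hp0 : (p : ℚ_[p]) ≠ 0 := by exact_mod_cast (Fact.out : p.Prime).ne_zero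
  have hscale (k : ℤ) : ∃ j' : D, j' * i = j' - i * j' ∧
      j' * j' = ((p : ℚ_[p]) ^ (m - 2 * k)) • (1 : D) := by
    obtain ⟨h1, h2⟩ := mul_conjugating hi hji hjj (p ^ (-k) * α : ℚ_[p]) (p ^ (-k) * β : ℚ_[p])
    refine ⟨_, h1, h2.trans ?_⟩
    congr 1
    rw [show m - 2 * k = -k + -k + m by ring, zpow_add₀ hp0, zpow_add₀ hp0, ← hau, ← hαβ']
    ring
  obtain ⟨k, hk | hk⟩ := Int.even_or_odd' m
  · exfalso
    obtain ⟨j', h1, h2⟩ := hscale k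
    rw [hk, sub_self, zpow_zero, one_smul] at h2
    have hj0 : j' ≠ 0 := by rintro rfl; simp at h2
    apply not_commute_of_conjugating hy hj0 h1
    obtain rfl | rfl := mul_self_eq_one_iff.1 h2 <;> simp
  · obtain ⟨j', h1, h2⟩ := hscale k
    rw [hk, add_sub_cancel_left, zpow_one] at h2
    have hj0 : j' ≠ 0 := by
      rintro rfl
      simpa [hp0] using h2.symm
    exact nonempty_quaternionAlgebra_equiv hdim hi (not_commute_of_conjugating hy hj0 h1) h1 h2

end Padic

end QuaternionDivision

/-- Let `p` be a prime and let `D`, `D'` be `4`-dimensional central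
simple algebras over `ℚ_p` which are division rings (every nonzero element is a unit).
Then `D ≅ D'` as `ℚ_p`-algebras: up to isomorphism there is a unique quaternion
division algebra over `ℚ_p`. -/
theorem padic_quaternion_division_algebra_unique
    (p : ℕ) [Fact p.Prime]
    (D D' : Type*) [Ring D] [Algebra ℚ_[p] D] [Ring D'] [Algebra ℚ_[p] D']
    (hdim : Module.finrank ℚ_[p] D = 4) (hdim' : Module.finrank ℚ_[p] D' = 4)
    [Algebra.IsCentral ℚ_[p] D] [IsSimpleRing D]
    [Algebra.IsCentral ℚ_[p] D'] [IsSimpleRing D']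
    (hdiv : ∀ x : D, x ≠ 0 → IsUnit x) (hdiv' : ∀ x : D', x ≠ 0 → IsUnit x) :
    Nonempty (D ≃ₐ[ℚ_[p]] D') := by
  let _ : DivisionRing D := .ofIsUnitOrEqZero fun a => or_iff_not_imp_right.2 (hdiv a)
  let _ : DivisionRing D' := .ofIsUnitOrEqZero fun a => or_iff_not_imp_right.2 (hdiv' a)
  obtain ⟨c, -, hc, -⟩ := QuaternionDivision.exists_generator hdim
  obtain ⟨e⟩ := QuaternionDivision.nonempty_quaternionAlgebra_equiv_of_noRootMod hdim hc
  obtain ⟨e'⟩ := QuaternionDivision.nonempty_quaternionAlgebra_equiv_of_noRootMod hdim' hc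
  exact ⟨e.symm.trans e'⟩
end

section
/- Let p be an odd prime and let a, b ∈ ℚ_p be nonzero. Then the quaternion algebra ℍ[ℚ_p, a, b] is isomorphic as a ℚ_p-algebra to the 2×2 matrix algebra over ℚ_p if and only if at least one of the following holds: (i) a is a square in ℚ_p; (ii) b is a square in ℚ_p; (iii) −a·b is a square in ℚ_p; (iv) a and b are both nonsquares in ℚ_p whose p-adic valuations are both even. -/
open Quaternion

/-- If `b = x² - a y²` is a norm from `F(√a)`, then
`ℍ[F, a, b]` is a matrix algebra. -/
theorem QuaternionAlgebra.nonempty_algEquiv_matrix_of_eq_sq_sub {F : Type*} [Field F]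
    (h2 : (2 : F) ≠ 0) {a b : F} (ha : a ≠ 0) (hb : b ≠ 0) {x y : F}
    (h : b = x ^ 2 - a * y ^ 2) :
    Nonempty (ℍ[F, a, b] ≃ₐ[F] Matrix (Fin 2) (Fin 2) F) := by
  let B : QuaternionAlgebra.Basis (Matrix (Fin 2) (Fin 2) F) a 0 b :=
    { i := !![0, a; 1, 0]
      j := !![x, -(a * y); y, -x]
      k := !![a * y, -(a * x); x, -(a * y)]
      i_mul_i := by ext i j; fin_cases i <;> fin_cases j <;> simp
      j_mul_j := by
        ext i j; fin_cases i <;> fin_cases j <;> simp [h] <;> ring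
      i_mul_j := by
        ext i j; fin_cases i <;> fin_cases j <;> simp
      j_mul_i := by
        ext i j; fin_cases i <;> fin_cases j <;> simp <;> ring }
  have hinj : Function.Injective B.liftHom := by
    rw [injective_iff_map_eq_zero]
    rintro ⟨r, u, v, w⟩ hq
    have e (i j : Fin 2) := congrFun (congrFun hq i) j
    have e00 := e 0 0
    have e01 := e 0 1
    have e10 := e 1 0
    have e11 := e 1 1
    simp [B, Basis.lift, Matrix.algebraMap_matrix_apply] at e00 e01 e10 e11
    have hr : r = 0 := mul_left_cancel₀ h2 (by linear_combination e00 + e11)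
    have hu : u = 0 := mul_left_cancel₀ (mul_ne_zero h2 ha)
      (by linear_combination e01 + a * e10)
    subst hr hu
    have hv : v = 0 := mul_left_cancel₀ hb
      (by linear_combination v * h + x * e00 - a * y * e10)
    have hw : w = 0 := mul_left_cancel₀ hb
      (by linear_combination w * h + x * e10 - y * e00)
    subst hv hw
    rfl
  have hbij : Function.Bijective B.liftHom := by
    refine ⟨hinj, ?_⟩
    refine (LinearMap.injective_iff_surjective_of_finrank_eq_finrank
      (f := B.liftHom.toLinearMap) ?_).1 hinj
    rw [QuaternionAlgebra.finrank_eq_four, Module.finrank_matrix]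
    simp
  exact ⟨AlgEquiv.ofBijective _ hbij⟩

/-- A split quaternion algebra contains a nonzero pure quaternion of norm zero. -/
theorem QuaternionAlgebra.exists_isotropic_of_algEquiv_matrix {F : Type*} [Field F]
    (h2 : (2 : F) ≠ 0) {a b : F} (e : ℍ[F, a, b] ≃ₐ[F] Matrix (Fin 2) (Fin 2) F) :
    ∃ u v w : F, a * u ^ 2 + b * v ^ 2 = a * b * w ^ 2 ∧ ¬ (u = 0 ∧ v = 0 ∧ w = 0) := by
  have hN : (!![0, 1; 0, 0] : Matrix (Fin 2) (Fin 2) F) ≠ 0 := fun h => by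
    simpa using congrFun (congrFun h 0) 1
  obtain ⟨q, hq⟩ := e.surjective !![0, 1; 0, 0]
  have hq0 : q ≠ 0 := by
    rintro rfl
    exact hN (by rw [← hq, map_zero])
  have hqq : q * q = 0 := e.injective (by
    rw [map_mul, hq, map_zero]
    ext i j; fin_cases i <;> fin_cases j <;> simp)
  obtain ⟨r, u, v, w⟩ := q
  rw [QuaternionAlgebra.mk_mul_mk, QuaternionAlgebra.ext_iff] at hqq
  simp at hqq
  obtain ⟨h0, h1, h3, h4⟩ := hqq
  have key (t : F) (ht : 2 * (r * t) = 0) : r = 0 ∨ t = 0 := by simpa [h2] using ht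
  by_cases hr : r = 0
  · subst hr
    refine ⟨u, v, w, by linear_combination h0, ?_⟩
    rintro ⟨rfl, rfl, rfl⟩
    exact hq0 rfl
  · have hu := (key u (by linear_combination h1)).resolve_left hr
    have hv := (key v (by linear_combination h3)).resolve_left hr
    have hw := (key w (by linear_combination h4)).resolve_left hr
    subst hu hv hw
    simp [hr] at h0

namespace Padic

variable {p : ℕ} [Fact p.Prime]

theorem norm_two_eq_one (hp : p ≠ 2) : ‖(2 : ℚ_[p])‖ = 1 := by
  have : ‖((2 : ℕ) : ℚ_[p])‖ = 1 := Padic.norm_natCast_eq_one_iff.2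
    ((Nat.coprime_primes Fact.out Nat.prime_two).2 hp)
  simpa using this

theorem isSquare_of_norm_sub_one_lt_one (hp : p ≠ 2) {t : ℚ_[p]} (ht : ‖t - 1‖ < 1) :
    IsSquare t := by
  have ht1 : ‖t‖ ≤ 1 := by
    have := Padic.nonarchimedean (t - 1) 1
    rw [sub_add_cancel, norm_one] at this
    exact this.trans (max_le ht.le le_rfl)
  let t' : ℤ_[p] := ⟨t, ht1⟩
  let f : Polynomial ℤ_[p] := Polynomial.X ^ 2 - Polynomial.C t'
  have h2 : ‖(2 : ℤ_[p])‖ = 1 := by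
    rw [PadicInt.norm_def]
    exact norm_two_eq_one hp
  have hf : ‖f.aeval (1 : ℤ_[p])‖ < ‖f.derivative.aeval (1 : ℤ_[p])‖ ^ 2 := by
    have h1 : f.aeval (1 : ℤ_[p]) = 1 - t' := by simp [f]
    have h3 : f.derivative.aeval (1 : ℤ_[p]) = 2 := by simp [f, one_add_one_eq_two]
    rw [h1, h3, h2, one_pow, norm_sub_rev]
    exact ht
  obtain ⟨z, hz, -⟩ := hensels_lemma hf
  refine ⟨z, ?_⟩
  have hz' : z ^ 2 - t' = 0 := by simpa [f] using hz
  have := congrArg (fun z : ℤ_[p] => (z : ℚ_[p])) (sub_eq_zero.1 hz')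
  simpa [t', sq] using this.symm

theorem valuation_eq_of_norm_eq {x y : ℚ_[p]} (hx : x ≠ 0) (hy : y ≠ 0) (h : ‖x‖ = ‖y‖) :
    x.valuation = y.valuation := by
  have hp1 : (1 : ℝ) < p := by exact_mod_cast (Fact.out : p.Prime).one_lt
  rw [norm_eq_zpow_neg_valuation hx, norm_eq_zpow_neg_valuation hy] at h
  simpa using zpow_right_injective₀ (by positivity) hp1.ne' h

/-- The norm form of an unramified quadratic extension takes values of even valuation. -/
theorem even_valuation_sq_sub_mul_sq (hp : p ≠ 2) {c : ℚ_[p]} (hc : ¬ IsSquare c)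
    (hv : Even c.valuation) (x y : ℚ_[p]) : Even (x ^ 2 - c * y ^ 2).valuation := by
  have hc0 : c ≠ 0 := by rintro rfl; exact hc IsSquare.zero
  by_cases hy : y = 0
  · simp [hy]
  by_cases hx : x = 0
  · subst hx
    rw [valuation_eq_of_norm_eq (y := c * y ^ 2) (by simp [hc0, hy]) (by simp [hc0, hy])
      (by simp), valuation_mul hc0 (by simp [hy])]
    simpa using hv.add (even_two_mul _)
  have hcy : c * y ^ 2 ≠ 0 := by simp [hc0, hy]
  have hx2 : x ^ 2 ≠ 0 := by simp [hx]
  have hne : x ^ 2 - c * y ^ 2 ≠ 0 := fun h => hc ⟨x / y, by field_simp; linear_combination -h⟩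
  have hvx : Even (x ^ 2).valuation := by simp
  have hvcy : Even (c * y ^ 2).valuation := by
    rw [valuation_mul hc0 (by simp [hy])]
    simpa using hv.add (even_two_mul _)
  by_cases hn : ‖x ^ 2‖ = ‖c * y ^ 2‖
  · have hle : ‖x ^ 2 - c * y ^ 2‖ ≤ ‖x ^ 2‖ := by
      have := Padic.nonarchimedean (x ^ 2) (-(c * y ^ 2))
      rwa [← sub_eq_add_neg, norm_neg, ← hn, max_self] at this
    rcases hle.lt_or_eq with hlt | heq
    · refine absurd ?_ hc
      have hsq : IsSquare (c * y ^ 2 / x ^ 2) := by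
        refine isSquare_of_norm_sub_one_lt_one hp ?_
        rw [div_sub_one hx2, norm_div, norm_sub_rev]
        exact (div_lt_one (norm_pos_iff.2 hx2)).2 hlt
      obtain ⟨s, hs⟩ := hsq
      refine ⟨s * x / y, ?_⟩
      field_simp at hs ⊢
      linear_combination hs
    · rwa [valuation_eq_of_norm_eq hne hx2 heq]
  · have hmax := Padic.add_eq_max_of_ne (q := x ^ 2) (r := -(c * y ^ 2)) (by rwa [norm_neg])
    rw [← sub_eq_add_neg, norm_neg] at hmax
    rcases max_choice ‖x ^ 2‖ ‖c * y ^ 2‖ with h | h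
    · rwa [valuation_eq_of_norm_eq hne hx2 (hmax.trans h)]
    · rwa [valuation_eq_of_norm_eq hne hcy (hmax.trans h)]

/-- An unramified norm form represents no element of odd valuation up to squares. -/
theorem eq_zero_of_sq_sub_mul_sq_eq (hp : p ≠ 2) {c d : ℚ_[p]} (hc : ¬ IsSquare c)
    (hcv : Even c.valuation) (hdv : ¬ Even d.valuation) {x y z : ℚ_[p]}
    (h : x ^ 2 - c * y ^ 2 = d * z ^ 2) : x = 0 ∧ y = 0 ∧ z = 0 := by
  have hd0 : d ≠ 0 := by rintro rfl; simp at hdv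
  have hz : z = 0 := by
    by_contra hz
    have := even_valuation_sq_sub_mul_sq hp hc hcv x y
    rw [h, valuation_mul hd0 (by simp [hz]), Int.even_add] at this
    exact hdv (this.2 (by simp))
  subst hz
  have hy : y = 0 := by
    by_contra hy
    exact hc ⟨x / y, by field_simp; linear_combination -h⟩
  subst hy
  exact ⟨by simpa using h, rfl, rfl⟩

theorem exists_eq_sq_mul_of_even_valuation {a : ℚ_[p]} (ha : a ≠ 0) (hv : Even a.valuation) :
    ∃ (s : ℚ_[p]) (u : ℤ_[p]), s ≠ 0 ∧ ‖u‖ = 1 ∧ a = s ^ 2 * u := by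
  obtain ⟨k, hk⟩ := hv
  have hp0 : (p : ℚ_[p]) ≠ 0 := NeZero.ne _
  have hs : (p : ℚ_[p]) ^ k ≠ 0 := zpow_ne_zero _ hp0
  have hpr : (p : ℝ) ≠ 0 := by exact_mod_cast (Fact.out : p.Prime).ne_zero
  have hu : ‖a / ((p : ℚ_[p]) ^ k) ^ 2‖ = 1 := by
    rw [norm_div, norm_pow, norm_p_zpow, norm_eq_zpow_neg_valuation ha, hk, ← zpow_natCast,
      ← zpow_mul, div_eq_one_iff_eq (zpow_ne_zero _ hpr)]
    congr 1
    push_cast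
    ring
  refine ⟨(p : ℚ_[p]) ^ k, ⟨_, hu.le⟩, hs, hu, ?_⟩
  change a = ((p : ℚ_[p]) ^ k) ^ 2 * (a / ((p : ℚ_[p]) ^ k) ^ 2)
  field_simp

theorem exists_eq_sq_sub_mul_sq_of_norm_eq_one (hp : p ≠ 2) {u v : ℤ_[p]} (hu : ‖u‖ = 1)
    (hv : ‖v‖ = 1) : ∃ x y : ℚ_[p], (v : ℚ_[p]) = x ^ 2 - u * y ^ 2 := by
  have hu' : PadicInt.toZMod u ≠ 0 := by
    intro h
    rw [← RingHom.mem_ker, PadicInt.ker_toZMod, IsLocalRing.mem_maximalIdeal,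
      PadicInt.mem_nonunits] at h
    exact h.ne hu
  obtain ⟨X, Y, hXY⟩ := FiniteField.exists_root_sum_quadratic (R := ZMod p)
    (f := Polynomial.X ^ 2 - Polynomial.C (PadicInt.toZMod v))
    (g := Polynomial.C (-PadicInt.toZMod u) * Polynomial.X ^ 2)
    (Polynomial.degree_X_pow_sub_C two_pos _)
    (Polynomial.degree_C_mul_X_pow 2 (neg_ne_zero.2 hu'))
    (by rw [ZMod.card]; exact Nat.odd_iff.1 ((Fact.out : p.Prime).odd_of_ne_two hp))
  obtain ⟨x, rfl⟩ := ZMod.ringHom_surjective (PadicInt.toZMod (p := p)) X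
  obtain ⟨y, rfl⟩ := ZMod.ringHom_surjective (PadicInt.toZMod (p := p)) Y
  have hlt : ‖x ^ 2 - u * y ^ 2 - v‖ < 1 := by
    rw [← PadicInt.mem_nonunits, ← IsLocalRing.mem_maximalIdeal, ← PadicInt.ker_toZMod,
      RingHom.mem_ker]
    simp at hXY
    simp only [map_sub, map_mul, map_pow]
    linear_combination hXY
  have hvn : ‖(v : ℚ_[p])‖ = 1 := hv
  have hv0 : (v : ℚ_[p]) ≠ 0 := norm_ne_zero_iff.1 (by rw [hvn]; exact one_ne_zero)
  have hlt' : ‖((x : ℚ_[p]) ^ 2 - u * y ^ 2) / v - 1‖ < 1 := by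
    rw [div_sub_one hv0, norm_div, hvn, div_one]
    simpa [PadicInt.norm_def] using hlt
  obtain ⟨r, hr⟩ := isSquare_of_norm_sub_one_lt_one hp hlt'
  have hr0 : r ≠ 0 := by
    rintro rfl
    rw [hr] at hlt'
    simp at hlt'
  refine ⟨x / r, y / r, ?_⟩
  rw [div_eq_iff hv0] at hr
  field_simp
  linear_combination -hr

theorem exists_eq_sq_sub_mul_sq_of_even_valuation (hp : p ≠ 2) {a b : ℚ_[p]} (ha : a ≠ 0)
    (hb : b ≠ 0) (hav : Even a.valuation) (hbv : Even b.valuation) :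
    ∃ x y : ℚ_[p], b = x ^ 2 - a * y ^ 2 := by
  obtain ⟨s, u, hs, hu, rfl⟩ := exists_eq_sq_mul_of_even_valuation ha hav
  obtain ⟨m, v, -, hv, rfl⟩ := exists_eq_sq_mul_of_even_valuation hb hbv
  obtain ⟨x, y, h⟩ := exists_eq_sq_sub_mul_sq_of_norm_eq_one hp hu hv
  refine ⟨m * x, m * y / s, ?_⟩
  rw [h]
  field_simp

end Padic

/-- Let `p` be an odd prime and let `a, b ∈ ℚ_p` be nonzero.  Then
`ℍ[ℚ_p, a, b] ≅ M₂(ℚ_p)` as `ℚ_p`-algebras if and only if `a` is a square, or `b` is a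
square, or `−a·b` is a square, or `a` and `b` are both nonsquares whose `p`-adic
valuations are both even. -/
theorem padic_quaternionAlgebra_isMatrixRing_iff
    (p : ℕ) [Fact p.Prime] (hp : p ≠ 2)
    (a b : ℚ_[p]) (ha : a ≠ 0) (hb : b ≠ 0) :
    Nonempty (ℍ[ℚ_[p], a, b] ≃ₐ[ℚ_[p]] Matrix (Fin 2) (Fin 2) ℚ_[p]) ↔
      (IsSquare a ∨ IsSquare b ∨ IsSquare (-(a * b)) ∨
        (¬ IsSquare a ∧ ¬ IsSquare b ∧ Even a.valuation ∧ Even b.valuation)) := by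
  constructor
  · rintro ⟨e⟩
    obtain ⟨u, v, w, h, hne⟩ :=
      QuaternionAlgebra.exists_isotropic_of_algEquiv_matrix two_ne_zero e
    by_contra! hcon
    obtain ⟨hsa, hsb, hsab, hev⟩ := hcon
    have hval_neg (x : ℚ_[p]) (hx : x ≠ 0) : (-x).valuation = x.valuation :=
      Padic.valuation_eq_of_norm_eq (neg_ne_zero.2 hx) hx (norm_neg x)
    have hval_div (x y : ℚ_[p]) (hx : x ≠ 0) (hy : y ≠ 0) :
        (-(x / y)).valuation = x.valuation - y.valuation := by
      rw [hval_neg _ (div_ne_zero hx hy), div_eq_mul_inv,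
        Padic.valuation_mul hx (inv_ne_zero hy), Padic.valuation_inv, sub_eq_add_neg]
    by_cases hav : Even a.valuation
    · have hbv := hev hsa hsb hav
      obtain ⟨rfl, rfl, rfl⟩ := Padic.eq_zero_of_sq_sub_mul_sq_eq hp (d := -(a / b)) (x := v)
        (y := w) (z := u) hsa hav (by rw [hval_div a b ha hb]; grind)
        (by field_simp; linear_combination h)
      exact hne ⟨rfl, rfl, rfl⟩
    by_cases hbv : Even b.valuation
    · obtain ⟨rfl, rfl, rfl⟩ := Padic.eq_zero_of_sq_sub_mul_sq_eq hp (d := -(b / a)) (x := u)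
        (y := w) (z := v) hsb hbv (by rw [hval_div b a hb ha]; grind)
        (by field_simp; linear_combination h)
      exact hne ⟨rfl, rfl, rfl⟩
    · have hab : Even (-(a * b)).valuation := by
        rw [hval_neg _ (mul_ne_zero ha hb), Padic.valuation_mul ha hb]
        grind
      obtain ⟨hu, rfl, rfl⟩ := Padic.eq_zero_of_sq_sub_mul_sq_eq hp (d := a * (a * b))
        (x := a * u) (y := v) (z := w) hsab hab
        (by rw [Padic.valuation_mul ha (mul_ne_zero ha hb), Padic.valuation_mul ha hb]; grind)
        (by linear_combination a * h)
      exact hne ⟨(mul_eq_zero.1 hu).resolve_left ha, rfl, rfl⟩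
  · intro h
    have hxy : ∃ x y : ℚ_[p], b = x ^ 2 - a * y ^ 2 := by
      rcases h with ⟨s, rfl⟩ | ⟨s, rfl⟩ | ⟨s, hs⟩ | ⟨-, -, hav, hbv⟩
      · have hs : s ≠ 0 := by rintro rfl; simp at ha
        exact ⟨(b + 1) / 2, (b - 1) / (2 * s), by field_simp; ring⟩
      · exact ⟨s, 0, by ring⟩
      · exact ⟨0, s / a, by field_simp; linear_combination -hs⟩
      · exact Padic.exists_eq_sq_sub_mul_sq_of_even_valuation hp ha hb hav hbv
    obtain ⟨x, y, h⟩ := hxy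
    exact QuaternionAlgebra.nonempty_algEquiv_matrix_of_eq_sq_sub two_ne_zero ha hb h
end

section
/- Let n be an odd positive integer that is not a perfect square and not a prime power. Let S be the set of units b in ℤ/nℤ for which there exist primes p and q dividing n, with e and f the exact multiplicities of p and q in n respectively, such that (b/p)^e = −1 and (b/q)^f = 1, where (·/p) denotes the Legendre symbol. Then 2·#S ≥ φ(n), where φ is Euler's totient function. -/
/-- A nonzero non-square has a prime factor of odd multiplicity. -/
theorem Nat.exists_prime_odd_factorization_of_not_isSquare {n : ℕ} (hn : n ≠ 0)
    (hsq : ¬ IsSquare n) : ∃ p, p.Prime ∧ p ∣ n ∧ Odd (n.factorization p) := by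
  by_contra! h
  apply hsq
  rw [← Nat.prod_factorization_pow_eq_self hn]
  refine Finset.isSquare_prod _ fun p hp => ?_
  rw [Nat.support_factorization, Nat.mem_primeFactors] at hp
  exact (Nat.not_odd_iff_even.mp (h p hp.1 hp.2.1)).isSquare_pow p

theorem legendreSym_val_eq_quadraticChar {n p : ℕ} [NeZero n] [Fact p.Prime] (hpn : p ∣ n)
    (b : ZMod n) :
    legendreSym p (b.val : ℤ) = quadraticChar (ZMod p) (ZMod.castHom hpn (ZMod p) b) := by
  rw [legendreSym, Int.cast_natCast, ZMod.natCast_val, ZMod.castHom_apply]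

theorem legendreSym_val_mul {n p : ℕ} [NeZero n] [Fact p.Prime] (hpn : p ∣ n) (a b : ZMod n) :
    legendreSym p ((a * b).val : ℤ) = legendreSym p (a.val : ℤ) * legendreSym p (b.val : ℤ) := by
  simp only [legendreSym_val_eq_quadraticChar hpn, map_mul]

theorem legendreSym_val_units {n p : ℕ} [NeZero n] [Fact p.Prime] (hpn : p ∣ n) (b : (ZMod n)ˣ) :
    legendreSym p ((b : ZMod n).val : ℤ) = 1 ∨ legendreSym p ((b : ZMod n).val : ℤ) = -1 := by
  rw [legendreSym_val_eq_quadraticChar hpn]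
  exact quadraticChar_dichotomy (b.isUnit.map (ZMod.castHom hpn (ZMod p))).ne_zero

/-- A unit modulo `n` that is a non-residue modulo `p` and is `1` modulo every other prime
factor of `n`. -/
theorem ZMod.exists_unit_legendreSym_eq_neg_one {n p : ℕ} [NeZero n] [Fact p.Prime] (hp2 : p ≠ 2)
    (hpn : p ∣ n) : ∃ u : (ZMod n)ˣ, legendreSym p ((u : ZMod n).val : ℤ) = -1 ∧
      ∀ (q : ℕ) [Fact q.Prime], q ∣ n → q ≠ p → legendreSym q ((u : ZMod n).val : ℤ) = 1 := by
  have hp : p.Prime := Fact.out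
  obtain ⟨a, ha⟩ := quadraticChar_exists_neg_one (F := ZMod p) (by rwa [ZMod.ringChar_zmod_n])
  have hcop : p.Coprime (ordCompl[p] n) := Nat.coprime_ordCompl hp (NeZero.ne n)
  obtain ⟨m, hmp, hmc⟩ := Nat.chineseRemainder hcop a.val 1
  have hma : (m : ZMod p) = a := by
    rw [(ZMod.natCast_eq_natCast_iff _ _ _).mpr hmp, ZMod.natCast_zmod_val]
  have hm : m.Coprime n := by
    rw [← Nat.ordProj_mul_ordCompl_eq_self n p]
    refine Nat.Coprime.mul_right (Nat.Coprime.pow_right _ ?_) ?_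
    · refine ((Nat.Prime.coprime_iff_not_dvd hp).mpr fun h => ?_).symm
      rw [(ZMod.natCast_eq_zero_iff _ _).mpr h] at hma
      simp [← hma] at ha
    · rw [Nat.Coprime, hmc.gcd_eq, Nat.gcd_one_left]
  refine ⟨ZMod.unitOfCoprime m hm, ?_, fun q _ hqn hqp => ?_⟩
  · rw [legendreSym_val_eq_quadraticChar hpn, ZMod.coe_unitOfCoprime, map_natCast, hma, ha]
  · have hq : q.Prime := Fact.out
    have hqc : q ∣ ordCompl[p] n := by
      rw [← Nat.ordProj_mul_ordCompl_eq_self n p] at hqn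
      exact (hq.dvd_mul.mp hqn).resolve_left fun h =>
        hqp ((Nat.prime_dvd_prime_iff_eq hq hp).mp (hq.dvd_of_dvd_pow h))
    have hm1 : (m : ZMod q) = 1 := by
      simpa using (ZMod.natCast_eq_natCast_iff _ _ _).mpr (hmc.of_dvd hqc)
    rw [legendreSym_val_eq_quadraticChar hqn, ZMod.coe_unitOfCoprime, map_natCast, hm1, map_one]

/-- A set containing `b` or a fixed translate of `b`, for every `b`, is at least half the group. -/
theorem Set.card_le_two_mul_ncard_of_mem_or_mul_mem {G : Type*} [Group G] [Finite G] {S : Set G}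
    (u : G) (h : ∀ b, b ∈ S ∨ u * b ∈ S) : Nat.card G ≤ 2 * S.ncard := by
  have hle : Sᶜ.ncard ≤ S.ncard :=
    Set.ncard_le_ncard_of_injOn (u * ·) (fun b hb => (h b).resolve_left hb)
      (mul_right_injective u).injOn
  have := Set.ncard_add_ncard_compl S
  lia

/-- Let `n` be an odd positive integer that is not a perfect square
and not a prime power.  Let `S` be the set of units `b` of `ℤ/nℤ` for which there
exist primes `p` and `q` dividing `n`, with exact multiplicities `e = v_p(n)` and
`f = v_q(n)`, such that `(b/p)^e = −1` and `(b/q)^f = 1` (Legendre symbols, applied to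
the integer lift `(b : ZMod n).val`).  Then `2·#S ≥ φ(n)`. -/
theorem half_of_units_witness_factor
    (n : ℕ) (hpos : 0 < n) (hodd : Odd n) (hsq : ¬ IsSquare n) (hpp : ¬ IsPrimePow n) :
    Nat.totient n ≤ 2 * Set.ncard {b : (ZMod n)ˣ |
      ∃ (p q : ℕ) (hp : p.Prime) (hq : q.Prime), p ∣ n ∧ q ∣ n ∧
        (@legendreSym p ⟨hp⟩ (((b : ZMod n).val : ℤ))) ^ (n.factorization p) = -1 ∧
        (@legendreSym q ⟨hq⟩ (((b : ZMod n).val : ℤ))) ^ (n.factorization q) = 1} := by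
  have : NeZero n := ⟨hpos.ne'⟩
  obtain ⟨p, hp, hpn, hpodd⟩ :=
    Nat.exists_prime_odd_factorization_of_not_isSquare hpos.ne' hsq
  obtain ⟨q, hq, hqn, hqp⟩ : ∃ q, q.Prime ∧ q ∣ n ∧ q ≠ p := by
    by_contra! h
    refine hpp (isPrimePow_iff_unique_prime_dvd.mpr ⟨p, ⟨hp, hpn⟩, ?_⟩)
    exact fun q hq => h q hq.1 hq.2
  have : Fact p.Prime := ⟨hp⟩
  have : Fact q.Prime := ⟨hq⟩
  have hp2 : p ≠ 2 := by
    rintro rfl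
    exact Nat.not_even_iff_odd.mpr hodd (even_iff_two_dvd.mpr hpn)
  obtain ⟨u, hup, huq⟩ := ZMod.exists_unit_legendreSym_eq_neg_one hp2 hpn
  rw [← ZMod.card_units_eq_totient, ← Nat.card_eq_fintype_card]
  refine Set.card_le_two_mul_ncard_of_mem_or_mul_mem u fun b => ?_
  have hbq : legendreSym q ((b : ZMod n).val : ℤ) ^ n.factorization q = 1 ∨
      legendreSym q ((b : ZMod n).val : ℤ) ^ n.factorization q = -1 := by
    rcases legendreSym_val_units hqn b with h | h <;> rw [h]
    · exact Or.inl (one_pow _)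
    · exact neg_one_pow_eq_or ℤ _
  have hubp : legendreSym p ((u * b : (ZMod n)ˣ) : ZMod n).val =
      -legendreSym p ((b : ZMod n).val : ℤ) := by
    rw [Units.val_mul, legendreSym_val_mul hpn, hup, neg_one_mul]
  have hubq : legendreSym q ((u * b : (ZMod n)ˣ) : ZMod n).val =
      legendreSym q ((b : ZMod n).val : ℤ) := by
    rw [Units.val_mul, legendreSym_val_mul hqn, huq q hqn hqp, one_mul]
  rcases legendreSym_val_units hpn b with hbp | hbp <;> rcases hbq with hbq | hbq
  · exact Or.inr ⟨p, q, hp, hq, hpn, hqn, by rw [hubp, hbp, hpodd.neg_one_pow], by rw [hubq, hbq]⟩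
  · exact Or.inl ⟨q, p, hq, hp, hqn, hpn, hbq, by rw [hbp, one_pow]⟩
  · exact Or.inl ⟨p, q, hp, hq, hpn, hqn, by rw [hbp, hpodd.neg_one_pow], hbq⟩
  · exact Or.inr ⟨q, p, hq, hp, hqn, hpn, by rw [hubq, hbq], by rw [hubp, hbp, neg_neg, one_pow]⟩
end

section
/- Let F be a field with char F ≠ 2 and let B be a central simple F-algebra with dim_F B = 4. Then there exist nonzero a, b ∈ F such that B is isomorphic as an F-algebra to the quaternion algebra ℍ[F, a, b]; that is, every quaternion algebra over F admits a standard form with generators i, j satisfying i² = a, j² = b, j·i = −i·j. -/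
open Quaternion

namespace QuaternionAlgebra.Basis

variable {F A : Type*} [Field F] [Ring A] [Nontrivial A] [Algebra F A] {a b : F}

/-- Over a field of characteristic not two, a standard quaternion basis whose two generators have
nonzero squares is linearly independent. -/
theorem liftHom_injective (h2 : (2 : F) ≠ 0) (ha : a ≠ 0) (hb : b ≠ 0) (q : Basis A a 0 b) :
    Function.Injective q.liftHom := by
  have hii : q.i * q.i = a • (1 : A) := by simp
  have hjj : q.j * q.j = b • (1 : A) := q.j_mul_j
  have hji : q.j * q.i = -(q.i * q.j) := by simp
  have hijj : q.i * q.j * q.j = b • q.i := by rw [mul_assoc, hjj]; simp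
  have smul_i_ne (r : F) (h : r • q.i = 0) : r = 0 := by
    have h' : (r * a) • (1 : A) = 0 := by
      rw [mul_smul, ← hii, ← smul_mul_assoc, h, zero_mul]
    simpa [ha] using h'
  have left_eq_zero (p r : F) (h : p • (1 : A) + r • q.i = 0) : p = 0 ∧ r = 0 := by
    have hconj : (b * p) • (1 : A) - (b * r) • q.i = 0 := by
      have : q.j * (p • (1 : A) + r • q.i) * q.j = 0 := by rw [h]; simp
      simp only [mul_add, add_mul, mul_smul_comm, smul_mul_assoc, mul_one, hji, neg_mul,
        hjj, hijj, smul_neg, smul_smul] at this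
      linear_combination (norm := module) this
    have hp : (2 * b * p) • (1 : A) = 0 := by
      linear_combination (norm := module) b • h + hconj
    have hp0 : p = 0 := by simpa [h2, hb] using hp
    subst hp0
    exact ⟨rfl, smul_i_ne r (by simpa using h)⟩
  rw [injective_iff_map_eq_zero]
  rintro ⟨p, r, s, t⟩ h
  have h : p • (1 : A) + r • q.i + s • q.j + t • (q.i * q.j) = 0 := by
    simpa [Basis.lift, Algebra.algebraMap_eq_smul_one] using h
  have hconj : (a * p) • (1 : A) + (a * r) • q.i - (a * s) • q.j - (a * t) • (q.i * q.j) = 0 := by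
    have hiij : q.i * (q.i * q.j) = a • q.j := by rw [← mul_assoc, hii]; simp
    have : q.i * (p • (1 : A) + r • q.i + s • q.j + t • (q.i * q.j)) * q.i = 0 := by rw [h]; simp
    simp only [mul_add, add_mul, mul_smul_comm, smul_mul_assoc, mul_one, hii, hiij, one_mul,
      mul_assoc, hji, mul_neg, smul_neg, smul_smul] at this
    linear_combination (norm := module) this
  have h1 : (2 * a * p) • (1 : A) + (2 * a * r) • q.i = 0 := by
    linear_combination (norm := module) a • h + hconj
  have hjk : (2 * a * s) • q.j + (2 * a * t) • (q.i * q.j) = 0 := by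
    linear_combination (norm := module) a • h - hconj
  have h3 : (2 * a * s * b) • (1 : A) + (2 * a * t * b) • q.i = 0 := by
    have : ((2 * a * s) • q.j + (2 * a * t) • (q.i * q.j)) * q.j = 0 := by rw [hjk, zero_mul]
    simpa only [add_mul, smul_mul_assoc, hjj, hijj, smul_smul] using this
  have h4 := left_eq_zero _ _ h1
  have h5 := left_eq_zero _ _ h3
  have h2a : 2 * a ≠ 0 := mul_ne_zero h2 ha
  simp only [mul_eq_zero, h2a, hb, false_or, or_false] at h4 h5
  obtain ⟨rfl, rfl⟩ := h4
  obtain ⟨rfl, rfl⟩ := h5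
  rfl

/-- A four-dimensional algebra containing a standard quaternion basis is a quaternion algebra. -/
theorem nonempty_algEquiv (h2 : (2 : F) ≠ 0) (ha : a ≠ 0) (hb : b ≠ 0)
    (hdim : Module.finrank F A = 4) (q : Basis A a 0 b) :
    Nonempty (A ≃ₐ[F] ℍ[F, a, b]) := by
  have : FiniteDimensional F A := Module.finite_of_finrank_pos (by omega)
  have hinj := q.liftHom_injective h2 ha hb
  have hsurj : Function.Surjective q.liftHom :=
    (LinearMap.injective_iff_surjective_of_finrank_eq_finrank (f := q.liftHom.toLinearMap)
      (by rw [hdim, QuaternionAlgebra.finrank_eq_four])).1 hinj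
  exact ⟨(AlgEquiv.ofBijective q.liftHom ⟨hinj, hsurj⟩).symm⟩

end QuaternionAlgebra.Basis

/-- In a four-dimensional division algebra, every noncentral element is quadratic. -/
theorem DivisionRing.exists_mul_self_eq_of_finrank_eq_four {F D : Type*} [Field F]
    [DivisionRing D] [Algebra F D] (hdim : Module.finrank F D = 4) {x y : D} (hxy : ¬ Commute x y) :
    ∃ s t : F, x * x = s • (1 : D) + t • x := by
  have hlin (r s : F) : Commute x (r • (1 : D) + s • x) :=
    ((Commute.one_right x).smul_right r).add_right ((Commute.refl x).smul_right s)
  have eq_zero_of_mul_eq {c e : D} (hc : Commute x c) (he : Commute x e) (h : c * y = e) :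
      c = 0 := by
    by_contra hc0
    exact hxy (by rw [(eq_inv_mul_iff_mul_eq₀ hc0).2 h]; exact hc.inv_right₀.mul_right he)
  have left_eq_zero (r s : F) (h : r • (1 : D) + s • x = 0) : r = 0 ∧ s = 0 := by
    have hs : s = 0 := by
      by_contra hs
      have hx : x = (-(s⁻¹ * r)) • (1 : D) := by
        have : s⁻¹ • (r • (1 : D) + s • x) = 0 := by rw [h, smul_zero]
        rw [smul_add, smul_smul, smul_smul, inv_mul_cancel₀ hs, one_smul] at this
        linear_combination (norm := module) this
      exact hxy (by rw [hx]; exact (Commute.one_left y).smul_left _)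
    subst hs
    exact ⟨by simpa using h, rfl⟩
  have hli : LinearIndependent F ![1, x, y, x * y] := by
    rw [Fintype.linearIndependent_iff]
    intro g hg
    simp only [Fin.sum_univ_four, Matrix.cons_val] at hg
    have h1 : (g 2 • (1 : D) + g 3 • x) * y = (-g 0) • (1 : D) + (-g 1) • x := by
      simp only [add_mul, smul_mul_assoc, one_mul]
      linear_combination (norm := module) hg
    have h2 := eq_zero_of_mul_eq (hlin _ _) (hlin _ _) h1
    rw [h2, zero_mul] at h1
    have h3 := left_eq_zero _ _ h2
    have h4 := left_eq_zero _ _ h1.symm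
    simp only [neg_eq_zero] at h4
    intro i
    fin_cases i
    exacts [h4.1, h4.2, h3.1, h3.2]
  have hspan := hli.span_eq_top_of_card_eq_finrank (by simp [hdim])
  have hmem : x * x ∈ Submodule.span F (Set.range ![1, x, y, x * y]) := hspan ▸ Submodule.mem_top
  obtain ⟨g, hg⟩ := (Submodule.mem_span_range_iff_exists_fun F).1 hmem
  simp only [Fin.sum_univ_four, Matrix.cons_val] at hg
  have h1 : (g 2 • (1 : D) + g 3 • x) * y = x * x - (g 0 • (1 : D) + g 1 • x) := by
    simp only [add_mul, smul_mul_assoc, one_mul]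
    linear_combination (norm := module) hg
  have h2 := eq_zero_of_mul_eq (hlin _ _)
    (((Commute.refl x).mul_right (Commute.refl x)).sub_right (hlin _ _)) h1
  rw [h2, zero_mul] at h1
  exact ⟨g 0, g 1, (sub_eq_zero.1 h1.symm)⟩

/-- A four-dimensional central division algebra over a field of characteristic not two has a
standard quaternion basis. -/
theorem DivisionRing.exists_quaternionBasis {F D : Type*} [Field F] [DivisionRing D] [Algebra F D]
    [Algebra.IsCentral F D] (h2 : (2 : F) ≠ 0) (hdim : Module.finrank F D = 4) :
    ∃ a b : F, a ≠ 0 ∧ b ≠ 0 ∧ Nonempty (QuaternionAlgebra.Basis D a 0 b) := by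
  obtain ⟨x, y, hxy⟩ : ∃ x y : D, ¬ Commute x y := by
    by_contra! h
    have hcenter : Subalgebra.center F D = ⊤ := by
      ext z
      simp only [Algebra.mem_top, iff_true]
      exact Subalgebra.mem_center_iff.2 fun w => (h w z).eq
    have hbot := Algebra.IsCentral.center_eq_bot F D
    rw [hcenter] at hbot
    have := Subalgebra.bot_eq_top_iff_finrank_eq_one.1 hbot.symm
    omega
  obtain ⟨s, t, hx⟩ := exists_mul_self_eq_of_finrank_eq_four hdim hxy
  obtain ⟨i, a, hi, hiy⟩ : ∃ (i : D) (a : F), i * i = a • (1 : D) ∧ ¬ Commute i y := by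
    refine ⟨x - (t / 2) • (1 : D), s + t ^ 2 / 4, ?_, fun h => hxy ?_⟩
    · simp only [mul_sub, sub_mul, mul_smul_comm, smul_mul_assoc, mul_one, one_mul, hx]
      have h4 : (4 : F) ≠ 0 := by
        rw [show (4 : F) = 2 * 2 by norm_num]; exact mul_ne_zero h2 h2
      match_scalars <;> field_simp <;> ring
    · simpa using h.add_left ((Commute.one_left y).smul_left (t / 2))
  have hi0 : i ≠ 0 := by rintro rfl; exact hiy (Commute.zero_left y)
  have ha : a ≠ 0 := by rintro rfl; simp [hi0] at hi
  obtain ⟨j, hj0, hij⟩ : ∃ j : D, j ≠ 0 ∧ j * i = -(i * j) := by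
    refine ⟨i * y - y * i, sub_ne_zero.2 hiy, ?_⟩
    have h1 : i * (i * y) = a • y := by rw [← mul_assoc, hi]; simp
    have h2 : y * i * i = a • y := by rw [mul_assoc, hi]; simp
    rw [sub_mul, mul_sub, h1, h2, mul_assoc]; abel
  have h2D : (2 : D) ≠ 0 := by
    simpa only [map_ofNat] using (map_ne_zero (algebraMap F D)).2 h2
  have hji : ¬ Commute j i := by
    intro h
    rw [h.eq, eq_neg_iff_add_eq_zero, ← two_mul] at hij
    simp_all
  obtain ⟨b, r, hj⟩ := exists_mul_self_eq_of_finrank_eq_four hdim hji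
  have hr : r = 0 := by
    have hcomm : j * j * i = i * (j * j) := by
      rw [mul_assoc, hij, mul_neg, ← mul_assoc, hij, neg_mul, neg_neg, mul_assoc]
    rw [hj] at hcomm
    simp only [add_mul, mul_add, smul_mul_assoc, mul_smul_comm, one_mul, mul_one] at hcomm
    by_contra hr
    exact hji (smul_right_injective D hr (add_left_cancel hcomm))
  subst hr
  have hb : b ≠ 0 := by rintro rfl; simp [hj0] at hj
  exact ⟨a, b, ha, hb, ⟨{
    i := i
    j := j
    k := i * j
    i_mul_i := by simpa using hi
    j_mul_j := by simpa using hj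
    i_mul_j := rfl
    j_mul_i := by simpa using hij }⟩⟩

/-- The split quaternion basis of the algebra of two-by-two matrices. -/
def Matrix.quaternionBasis (F D : Type*) [Field F] [Ring D] [Algebra F D] :
    QuaternionAlgebra.Basis (Matrix (Fin 2) (Fin 2) D) (1 : F) 0 1 where
  i := !![1, 0; 0, -1]
  j := !![0, 1; 1, 0]
  k := !![0, 1; -1, 0]
  i_mul_i := by simp [Matrix.one_fin_two]
  j_mul_j := by simp [Matrix.one_fin_two]
  i_mul_j := by simp
  j_mul_i := by simp

/-- Let `F` be a field with `char F ≠ 2` and let `B` be a central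
simple `F`-algebra with `dim_F B = 4`.  Then there exist nonzero `a, b ∈ F` such that
`B ≅ ℍ[F, a, b]` as `F`-algebras: every quaternion algebra over `F` admits a standard
form with generators `i, j` satisfying `i² = a`, `j² = b`, `j·i = −i·j`. -/
theorem centralSimple_dim_four_isQuaternionAlgebra
    (F B : Type*) [Field F] (hchar : (ringChar F) ≠ 2)
    [Ring B] [Algebra F B]
    [Algebra.IsCentral F B] [IsSimpleRing B]
    (hdim : Module.finrank F B = 4) :
    ∃ a b : F, a ≠ 0 ∧ b ≠ 0 ∧ Nonempty (B ≃ₐ[F] ℍ[F, a, b]) := by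
  have h2 : (2 : F) ≠ 0 := Ring.two_ne_zero hchar
  have : FiniteDimensional F B := Module.finite_of_finrank_pos (by omega)
  have : IsArtinianRing B := IsArtinianRing.of_finite F B
  obtain ⟨n, hn, D, _, _, ⟨e⟩⟩ := IsSimpleRing.exists_algEquiv_matrix_divisionRing F B
  have hdimD : n * n * Module.finrank F D = 4 := by
    rw [← hdim, e.toLinearEquiv.finrank_eq, Module.finrank_matrix]
    simp
  have hn0 : n ≠ 0 := hn.out
  have hD0 : Module.finrank F D ≠ 0 := by intro h; simp [h] at hdimD
  have hn2 : n ≤ 2 := by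
    by_contra! h
    nlinarith [Nat.pos_of_ne_zero hD0, Nat.mul_le_mul h h]
  obtain rfl | rfl : n = 1 ∨ n = 2 := by omega
  · obtain ⟨f⟩ : Nonempty (B ≃ₐ[F] D) := by
      have g : Matrix (Fin 1) (Fin 1) D ≃ₐ[F] D := by
        convert Matrix.uniqueAlgEquiv (R := F) (m := Fin 1) (A := D)
      exact ⟨e.trans g⟩
    have : Algebra.IsCentral F D := .of_algEquiv F B D f
    obtain ⟨a, b, ha, hb, ⟨q⟩⟩ := DivisionRing.exists_quaternionBasis (D := D) h2 (by omega)
    exact ⟨a, b, ha, hb,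
      (q.compHom f.symm.toAlgHom).nonempty_algEquiv h2 ha hb hdim⟩
  · exact ⟨1, 1, one_ne_zero, one_ne_zero,
      ((Matrix.quaternionBasis F D).compHom e.symm.toAlgHom).nonempty_algEquiv
        h2 one_ne_zero one_ne_zero hdim⟩
end
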